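/- arXiv:1609.03111 — 6 statements merged into one kernel-verified Lean document; each statement's English description precedes it below -/
import Mathlib

section
/- For every η ∈ Span(T_log) there exists η̃ ∈ Span(T_log) such that Δ̃η(ρ,θ) = ρ^{-2} η̃(ρ,θ) for all ρ > 0 and θ ∈ ℝ. -/
open Real Set

/-- Partial derivative in the `ρ` variable of a function of `(ρ, θ)`. -/
noncomputable def pd_rho (u : ℝ → ℝ → ℝ) : ℝ → ℝ → ℝ :=
  fun ρ θ => deriv (fun r => u r θ) ρ

/-- Partial derivative in the `θ` variable of a function of `(ρ, θ)`. -/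
noncomputable def pd_theta (u : ℝ → ℝ → ℝ) : ℝ → ℝ → ℝ :=
  fun ρ θ => deriv (fun t => u ρ t) θ

/-- The operator `u ↦ ρ ∂_ρ u`. -/
noncomputable def rhoDrho (u : ℝ → ℝ → ℝ) : ℝ → ℝ → ℝ :=
  fun ρ θ => ρ * deriv (fun r => u r θ) ρ

/-- The model Laplacian `Δ̃ = ∂_ρ² + ρ⁻¹ ∂_ρ + β⁻² ρ⁻² ∂_θ²`. -/
noncomputable def tLap (β : ℝ) (u : ℝ → ℝ → ℝ) : ℝ → ℝ → ℝ :=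
  fun ρ θ => pd_rho (pd_rho u) ρ θ + ρ⁻¹ * pd_rho u ρ θ
    + (β ^ 2)⁻¹ * (ρ ^ 2)⁻¹ * pd_theta (pd_theta u) ρ θ

/-- The function `ρ^{2j+k/β} (log ρ)^m cos (l θ)`. -/
noncomputable def tlogCos (β : ℝ) (j k m l : ℕ) : ℝ → ℝ → ℝ :=
  fun ρ θ => ρ ^ (2 * (j : ℝ) + (k : ℝ) / β) * (Real.log ρ) ^ m * Real.cos (l * θ)

/-- The function `ρ^{2j+k/β} (log ρ)^m sin (l θ)`. -/
noncomputable def tlogSin (β : ℝ) (j k m l : ℕ) : ℝ → ℝ → ℝ :=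
  fun ρ θ => ρ ^ (2 * (j : ℝ) + (k : ℝ) / β) * (Real.log ρ) ^ m * Real.sin (l * θ)

/-- Index conditions for `T_log`: `k - l` is a nonnegative even integer and
`m ≤ max (0, k - 1)`. -/
def TlogIdx (j k m l : ℕ) : Prop :=
  (∃ i : ℕ, k = l + 2 * i) ∧ m ≤ max 0 (k - 1)

/-- The set `T_log` of model functions. -/
def Tlog (β : ℝ) : Set (ℝ → ℝ → ℝ) :=
  {f | ∃ j k m l : ℕ, TlogIdx j k m l ∧ (f = tlogCos β j k m l ∨ f = tlogSin β j k m l)}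

/-- The functions removed from `ρ⁻² · T_log` to form `T_rhs`. -/
def TrhsBad (β : ℝ) : Set (ℝ → ℝ → ℝ) :=
  {g | (g = fun ρ _ => ρ ^ (-2 : ℝ)) ∨
    ∃ k : ℕ, 0 < k ∧
      (g = (fun ρ θ => ρ ^ ((k : ℝ) / β - 2) * (Real.log ρ) ^ (k - 1) * Real.cos (k * θ)) ∨
       g = (fun ρ θ => ρ ^ ((k : ℝ) / β - 2) * (Real.log ρ) ^ (k - 1) * Real.sin (k * θ)))}

/-- The set `T_rhs`. -/
def Trhs (β : ℝ) : Set (ℝ → ℝ → ℝ) :=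
  {g | ∃ f ∈ Tlog β, g = fun ρ θ => ρ ^ (-2 : ℝ) * f ρ θ} \ TrhsBad β

/-- Membership in `Õ(q)`: a smooth, `2π`-periodic (in `θ`) function on `(0,1/2) × ℝ`
all of whose weighted derivatives `(ρ∂_ρ)^{k₁} ∂_θ^{k₂} u` are bounded by `C ρ^q`. -/
def OTilde (q : ℝ) (u : ℝ → ℝ → ℝ) : Prop :=
  ContDiffOn ℝ (⊤ : ℕ∞) (Function.uncurry u) (Set.Ioo (0 : ℝ) (1 / 2) ×ˢ (Set.univ : Set ℝ)) ∧
  (∀ ρ θ : ℝ, u ρ (θ + 2 * Real.pi) = u ρ θ) ∧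
  ∀ k1 k2 : ℕ, ∃ C : ℝ, ∀ ρ θ : ℝ, 0 < ρ → ρ < 1 / 2 →
    |(rhoDrho^[k1] (pd_theta^[k2] u)) ρ θ| ≤ C * ρ ^ q

/-- `u` has an expansion up to order `q`. -/
def HasExpansion (β q : ℝ) (u : ℝ → ℝ → ℝ) : Prop :=
  ∃ η ∈ Submodule.span ℝ (Tlog β), OTilde q (fun ρ θ => u ρ θ - η ρ θ)

theorem TlogIdx.pred {j k m l : ℕ} (h : TlogIdx j k m l) : TlogIdx j k (m - 1) l :=
  ⟨h.1, (Nat.sub_le m 1).trans h.2⟩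

theorem tlogCos_mem_span {β : ℝ} {j k m l : ℕ} (h : TlogIdx j k m l) :
    tlogCos β j k m l ∈ Submodule.span ℝ (Tlog β) :=
  Submodule.subset_span ⟨j, k, m, l, h, Or.inl rfl⟩

theorem tlogSin_mem_span {β : ℝ} {j k m l : ℕ} (h : TlogIdx j k m l) :
    tlogSin β j k m l ∈ Submodule.span ℝ (Tlog β) :=
  Submodule.subset_span ⟨j, k, m, l, h, Or.inr rfl⟩

theorem hasDerivAt_rpow_mul_log_pow (a : ℝ) (m : ℕ) {ρ : ℝ} (hρ : 0 < ρ) :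
    HasDerivAt (fun r : ℝ => r ^ a * Real.log r ^ m)
      (ρ⁻¹ * (a * (ρ ^ a * Real.log ρ ^ m) + m * (ρ ^ a * Real.log ρ ^ (m - 1)))) ρ := by
  refine HasDerivAt.congr_deriv ((Real.hasDerivAt_rpow_const (p := a) (Or.inl hρ.ne')).mul
    ((Real.hasDerivAt_log hρ.ne').pow m)) ?_
  rw [Real.rpow_sub_one hρ.ne']
  ring

/-- The span of `Tlog β` is closed under `ρ ∂_ρ` on `ρ > 0`. -/
theorem exists_rho_deriv_mem_span_Tlog {β : ℝ} {η : ℝ → ℝ → ℝ}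
    (hη : η ∈ Submodule.span ℝ (Tlog β)) :
    ∃ ζ ∈ Submodule.span ℝ (Tlog β), ∀ ρ θ : ℝ, 0 < ρ →
      HasDerivAt (fun r => η r θ) (ρ⁻¹ * ζ ρ θ) ρ := by
  induction hη using Submodule.span_induction with
  | mem f hf =>
    obtain ⟨j, k, m, l, h, rfl | rfl⟩ := hf
    · refine ⟨(2 * (j : ℝ) + k / β) • tlogCos β j k m l + (m : ℝ) • tlogCos β j k (m - 1) l,
        add_mem (Submodule.smul_mem _ _ (tlogCos_mem_span h))
          (Submodule.smul_mem _ _ (tlogCos_mem_span h.pred)), fun ρ θ hρ => ?_⟩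
      refine HasDerivAt.congr_deriv ((hasDerivAt_rpow_mul_log_pow (2 * (j : ℝ) + k / β) m hρ).mul_const
        (Real.cos (l * θ))) ?_
      simp only [tlogCos, Pi.add_apply, Pi.smul_apply, smul_eq_mul]
      ring
    · refine ⟨(2 * (j : ℝ) + k / β) • tlogSin β j k m l + (m : ℝ) • tlogSin β j k (m - 1) l,
        add_mem (Submodule.smul_mem _ _ (tlogSin_mem_span h))
          (Submodule.smul_mem _ _ (tlogSin_mem_span h.pred)), fun ρ θ hρ => ?_⟩
      refine HasDerivAt.congr_deriv ((hasDerivAt_rpow_mul_log_pow (2 * (j : ℝ) + k / β) m hρ).mul_const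
        (Real.sin (l * θ))) ?_
      simp only [tlogSin, Pi.add_apply, Pi.smul_apply, smul_eq_mul]
      ring
  | zero =>
    exact ⟨0, zero_mem _, fun ρ θ _ => by simpa using hasDerivAt_const ρ (0 : ℝ)⟩
  | add f g _ _ hf hg =>
    obtain ⟨f', hf', hf⟩ := hf
    obtain ⟨g', hg', hg⟩ := hg
    refine ⟨f' + g', add_mem hf' hg', fun ρ θ hρ => ?_⟩
    simpa only [Pi.add_apply, mul_add] using (hf ρ θ hρ).fun_add (hg ρ θ hρ)
  | smul c f _ hf =>
    obtain ⟨f', hf', hf⟩ := hf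
    refine ⟨c • f', Submodule.smul_mem _ _ hf', fun ρ θ hρ => ?_⟩
    simpa only [Pi.smul_apply, smul_eq_mul, mul_left_comm] using (hf ρ θ hρ).const_mul c

/-- The span of `Tlog β` is closed under `∂_θ`. -/
theorem exists_theta_deriv_mem_span_Tlog {β : ℝ} {η : ℝ → ℝ → ℝ}
    (hη : η ∈ Submodule.span ℝ (Tlog β)) :
    ∃ ζ ∈ Submodule.span ℝ (Tlog β), ∀ ρ θ : ℝ, HasDerivAt (fun t => η ρ t) (ζ ρ θ) θ := by
  induction hη using Submodule.span_induction with
  | mem f hf =>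
    obtain ⟨j, k, m, l, h, rfl | rfl⟩ := hf
    · refine ⟨(-(l : ℝ)) • tlogSin β j k m l,
        Submodule.smul_mem _ _ (tlogSin_mem_span h), fun ρ θ => ?_⟩
      refine HasDerivAt.congr_deriv (((hasDerivAt_const_mul (l : ℝ)).cos).const_mul
        (ρ ^ (2 * (j : ℝ) + k / β) * Real.log ρ ^ m)) ?_
      simp only [tlogSin, Pi.smul_apply, smul_eq_mul]
      ring
    · refine ⟨(l : ℝ) • tlogCos β j k m l,
        Submodule.smul_mem _ _ (tlogCos_mem_span h), fun ρ θ => ?_⟩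
      refine HasDerivAt.congr_deriv (((hasDerivAt_const_mul (l : ℝ)).sin).const_mul
        (ρ ^ (2 * (j : ℝ) + k / β) * Real.log ρ ^ m)) ?_
      simp only [tlogCos, Pi.smul_apply, smul_eq_mul]
      ring
  | zero => exact ⟨0, zero_mem _, fun ρ θ => hasDerivAt_const θ (0 : ℝ)⟩
  | add f g _ _ hf hg =>
    obtain ⟨f', hf', hf⟩ := hf
    obtain ⟨g', hg', hg⟩ := hg
    exact ⟨f' + g', add_mem hf' hg', fun ρ θ => (hf ρ θ).fun_add (hg ρ θ)⟩
  | smul c f _ hf =>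
    obtain ⟨f', hf', hf⟩ := hf
    exact ⟨c • f', Submodule.smul_mem _ _ hf', fun ρ θ => (hf ρ θ).const_mul c⟩

/-- for every `η ∈ Span(T_log)` there is `η̃ ∈ Span(T_log)` with
`Δ̃ η = ρ⁻² η̃` for all `ρ > 0`, `θ ∈ ℝ`. -/
theorem stmt1 (β : ℝ) (hβ0 : 0 < β) (hβ1 : β < 1)
    (η : ℝ → ℝ → ℝ) (hη : η ∈ Submodule.span ℝ (Tlog β)) :
    ∃ η' ∈ Submodule.span ℝ (Tlog β),
      ∀ ρ θ : ℝ, 0 < ρ → tLap β η ρ θ = ρ ^ (-2 : ℝ) * η' ρ θ := by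
  obtain ⟨η₁, hη₁, h₁⟩ := exists_rho_deriv_mem_span_Tlog hη
  obtain ⟨η₂, hη₂, h₂⟩ := exists_rho_deriv_mem_span_Tlog hη₁
  obtain ⟨ζ₁, hζ₁, g₁⟩ := exists_theta_deriv_mem_span_Tlog hη
  obtain ⟨ζ₂, hζ₂, g₂⟩ := exists_theta_deriv_mem_span_Tlog hζ₁
  refine ⟨η₂ + (β ^ 2)⁻¹ • ζ₂, add_mem hη₂ (Submodule.smul_mem _ _ hζ₂), fun ρ θ hρ => ?_⟩
  have hρρ : pd_rho (pd_rho η) ρ θ = -(ρ ^ 2)⁻¹ * η₁ ρ θ + ρ⁻¹ * (ρ⁻¹ * η₂ ρ θ) := by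
    refine (((hasDerivAt_inv hρ.ne').mul (h₂ ρ θ hρ)).congr_of_eventuallyEq ?_).deriv
    filter_upwards [eventually_gt_nhds hρ] with r hr using (h₁ r θ hr).deriv
  have hθθ : pd_theta (pd_theta η) ρ θ = ζ₂ ρ θ := by
    have hθ : pd_theta η = ζ₁ := funext₂ fun r t => (g₁ r t).deriv
    rw [hθ]
    exact (g₂ ρ θ).deriv
  have hpow : ρ ^ (-2 : ℝ) = (ρ ^ 2)⁻¹ := by
    rw [Real.rpow_neg hρ.le, Real.rpow_two]
  rw [tLap, hρρ, hθθ, show pd_rho η ρ θ = ρ⁻¹ * η₁ ρ θ from (h₁ ρ θ hρ).deriv, hpow]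
  simp only [Pi.add_apply, Pi.smul_apply, smul_eq_mul]
  ring
end

section
/- Let j,k,l,m be nonnegative integers with k−l a nonnegative even integer and m ≤ max(0, k−1), and let v(ρ,θ) = ρ^{2j+k/β}(log ρ)^m cos(lθ), an element of T_log. Suppose it is NOT the case that j = 0 and k = l = m+1, and NOT the case that j = k = l = 0 (hence m = 0). Then there exists u ∈ Span(T_log) such that Δ̃u(ρ,θ) = ρ^{-2} v(ρ,θ) for all ρ > 0 and θ ∈ ℝ. -/
open Real Set

open Polynomial in
theorem exists_polynomial_nonresonant (a b : ℝ) (ha : a ≠ 0) (m : ℕ) :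
    ∃ P : ℝ[X], P.natDegree ≤ m ∧
      C a * P + C b * derivative P + derivative (derivative P) = X ^ m := by
  induction m using Nat.strong_induction_on with
  | _ m ih =>
    have hC : (C a : ℝ[X]) * C a⁻¹ = 1 := by rw [← C_mul, mul_inv_cancel₀ ha, C_1]
    match m with
    | 0 => exact ⟨C a⁻¹, by simp, by simpa using hC⟩
    | 1 =>
      obtain ⟨P, hP, hPe⟩ := ih 0 (by simp)
      refine ⟨C a⁻¹ * (X - C b * P), by compute_degree!; omega, ?_⟩
      simp only [derivative_mul, derivative_C, derivative_sub, derivative_X, derivative_one, zero_mul,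
        zero_add, zero_sub]
      linear_combination X * hC - C a⁻¹ * C b * hPe
    | n + 2 =>
      obtain ⟨P, hP, hPe⟩ := ih (n + 1) (by simp)
      obtain ⟨Q, hQ, hQe⟩ := ih n (by simp)
      refine ⟨C a⁻¹ * (X ^ (n + 2) - C b * (n + 2 : ℝ[X]) * P
        - ((n + 2) * (n + 1) : ℝ[X]) * Q), by compute_degree!; omega, ?_⟩
      simp
      linear_combination X ^ (n + 2) * hC - C a⁻¹ * C b * (n + 2 : ℝ[X]) * hPe
        - C a⁻¹ * ((n + 2) * (n + 1) : ℝ[X]) * hQe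

open Polynomial in
theorem exists_polynomial_resonant (b : ℝ) (hb : b ≠ 0) (m : ℕ) :
    ∃ P : ℝ[X], P.natDegree ≤ m + 1 ∧
    C b * derivative P + derivative (derivative P) = X ^ m := by
  induction m with
  | zero =>
    refine ⟨C b⁻¹ * X, by compute_degree!, ?_⟩
    simp [← C_mul, hb]
  | succ n ih =>
    obtain ⟨P, hP, hPe⟩ := ih
    obtain ⟨c, hc⟩ : ∃ c : ℝ, b * c * (n + 2 : ℕ) = 1 :=
      ⟨(b * (n + 2 : ℕ))⁻¹, by field_simp⟩
    have hC : (C b : ℝ[X]) * C c * (n + 2) = 1 := by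
      have h := congrArg (C : ℝ → ℝ[X]) hc
      rw [C_mul, C_mul, C_1, C_eq_natCast] at h
      exact_mod_cast h
    refine ⟨C c * (X ^ (n + 2) - ((n + 2) * (n + 1) : ℝ[X]) * P),
      by compute_degree!; omega, ?_⟩
    simp
    linear_combination X ^ (n + 1) * hC
      - C c * ((n + 2) * (n + 1) : ℝ[X]) * hPe

/-- The function `ρ ↦ ρ^s P(log ρ)`. -/
noncomputable def rpowLog (s : ℝ) (P : Polynomial ℝ) (ρ : ℝ) : ℝ :=
  ρ ^ s * P.eval (Real.log ρ)

open Polynomial in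
theorem hasDerivAt_rpowLog (s : ℝ) (P : ℝ[X]) {ρ : ℝ} (hρ : 0 < ρ) :
    HasDerivAt (rpowLog s P) (rpowLog (s - 1) (C s * P + derivative P) ρ) ρ := by
  have h1 := (Real.hasDerivAt_rpow_const (p := s) (Or.inl hρ.ne')).mul
    ((P.hasDerivAt (Real.log ρ)).comp ρ (Real.hasDerivAt_log hρ.ne'))
  refine h1.congr_deriv ?_
  simp only [rpowLog, eval_add, eval_mul, eval_C, Function.comp_apply]
  rw [Real.rpow_sub_one hρ.ne']
  field_simp

open Polynomial in
theorem tLap_rpowLog_cos (β s : ℝ) (P : ℝ[X]) (l : ℕ) {ρ : ℝ} (hρ : 0 < ρ) (θ : ℝ) :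
    tLap β (fun ρ θ => rpowLog s P ρ * Real.cos (l * θ)) ρ θ =
      rpowLog (s - 2) (C (s ^ 2 - (l / β) ^ 2) * P + C (2 * s) * derivative P
        + derivative (derivative P)) ρ * Real.cos (l * θ) := by
  have hρ1 : ∀ r : ℝ, 0 < r → pd_rho (fun ρ θ => rpowLog s P ρ * Real.cos (l * θ)) r θ =
      rpowLog (s - 1) (C s * P + derivative P) r * Real.cos (l * θ) := fun r hr =>
    ((hasDerivAt_rpowLog s P hr).mul_const _).deriv
  have hρ2 : pd_rho (pd_rho (fun ρ θ => rpowLog s P ρ * Real.cos (l * θ))) ρ θ =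
      rpowLog (s - 1 - 1) (C (s - 1) * (C s * P + derivative P)
        + derivative (C s * P + derivative P)) ρ * Real.cos (l * θ) := by
    refine HasDerivAt.deriv ?_
    refine ((hasDerivAt_rpowLog (s - 1) (C s * P + derivative P) hρ).mul_const
      _).congr_of_eventuallyEq ?_
    filter_upwards [lt_mem_nhds hρ] with r hr using hρ1 r hr
  have hlin : ∀ t : ℝ, HasDerivAt (fun t : ℝ => (l : ℝ) * t) l t := fun t => by
    simpa using (hasDerivAt_id t).const_mul (l : ℝ)
  have hθ1 : pd_theta (fun ρ θ => rpowLog s P ρ * Real.cos (l * θ)) =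
      fun ρ θ => rpowLog s P ρ * (-Real.sin (l * θ) * l) := by
    funext r t
    exact ((hlin t).cos.const_mul _).deriv
  have hθ2 : pd_theta (pd_theta (fun ρ θ => rpowLog s P ρ * Real.cos (l * θ))) ρ θ =
      rpowLog s P ρ * (-(Real.cos (l * θ) * l) * l) := by
    rw [hθ1]
    exact (((hlin θ).sin.neg.mul_const _).const_mul _).deriv
  rw [tLap, hρ2, hρ1 ρ hρ, hθ2, show s - 2 = s - 1 - 1 by ring]
  simp only [rpowLog, Real.rpow_sub_one hρ.ne', eval_add, eval_mul, eval_C, derivative_add,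
    derivative_mul, derivative_C, eval_zero]
  rw [div_pow, div_eq_mul_inv _ (β ^ 2)]
  field_simp
  ring

theorem rpowLog_cos_mem_span_Tlog (β : ℝ) (j k l n : ℕ) (P : Polynomial ℝ)
    (hkl : ∃ i : ℕ, k = l + 2 * i) (hn : n ≤ max 0 (k - 1)) (hP : P.natDegree ≤ n) :
    (fun ρ θ => rpowLog (2 * (j : ℝ) + (k : ℝ) / β) P ρ * Real.cos (l * θ)) ∈
      Submodule.span ℝ (Tlog β) := by
  have hsum : (fun ρ θ => rpowLog (2 * (j : ℝ) + (k : ℝ) / β) P ρ * Real.cos (l * θ)) =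
      ∑ i ∈ Finset.range (n + 1), P.coeff i • tlogCos β j k i l := by
    funext ρ θ
    simp only [rpowLog, Finset.sum_apply, Pi.smul_apply, smul_eq_mul, tlogCos]
    rw [Polynomial.eval_eq_sum_range' (Nat.lt_succ_of_le hP), Finset.mul_sum, Finset.sum_mul]
    exact Finset.sum_congr rfl fun i _ => by ring
  rw [hsum]
  refine Submodule.sum_mem _ fun i hi => Submodule.smul_mem _ _ (Submodule.subset_span ?_)
  exact ⟨j, k, i, l, ⟨hkl, by have := Finset.mem_range.mp hi; omega⟩, Or.inl rfl⟩

/-- solvability of `Δ̃ u = ρ⁻² v` in `Span(T_log)` for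
`v = ρ^{2j+k/β} (log ρ)^m cos (lθ) ∈ T_log`, except in the two excluded cases. -/
theorem stmt2 (β : ℝ) (hβ0 : 0 < β) (hβ1 : β < 1)
    (j k m l : ℕ) (hkl : ∃ i : ℕ, k = l + 2 * i) (hm : m ≤ max 0 (k - 1))
    (hexc1 : ¬(j = 0 ∧ k = l ∧ k = m + 1))
    (hexc2 : ¬(j = 0 ∧ k = 0 ∧ l = 0)) :
    ∃ u ∈ Submodule.span ℝ (Tlog β),
      ∀ ρ θ : ℝ, 0 < ρ → tLap β u ρ θ = ρ ^ (-2 : ℝ) * tlogCos β j k m l ρ θ := by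
  obtain ⟨n, P, hn, hP, hPe⟩ : ∃ (n : ℕ) (P : Polynomial ℝ), n ≤ max 0 (k - 1) ∧
      P.natDegree ≤ n ∧
      Polynomial.C ((2 * (j : ℝ) + k / β) ^ 2 - (l / β) ^ 2) * P
        + Polynomial.C (2 * (2 * (j : ℝ) + k / β)) * Polynomial.derivative P
        + Polynomial.derivative (Polynomial.derivative P) = Polynomial.X ^ m := by
    by_cases hres : j = 0 ∧ k = l
    · obtain ⟨rfl, rfl⟩ := hres
      have hk : 0 < k := by omega
      have hs : 2 * (2 * ((0 : ℕ) : ℝ) + k / β) ≠ 0 := by positivity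
      obtain ⟨P, hP, hPe⟩ := exists_polynomial_resonant _ hs m
      exact ⟨m + 1, P, by omega, hP, by simpa using hPe⟩
    · have hlt : (l : ℝ) / β < 2 * j + k / β := by
        have hlk : (l : ℝ) / β ≤ k / β := by
          gcongr
          omega
        rcases Nat.eq_zero_or_pos j with rfl | hj
        · have : (l : ℝ) / β < k / β := by
            gcongr
            omega
          simpa using this
        · have : (0 : ℝ) < j := by exact_mod_cast hj
          linarith
      have hl : (0 : ℝ) ≤ l / β := by positivity
      obtain ⟨P, hP, hPe⟩ := exists_polynomial_nonresonant
        ((2 * (j : ℝ) + k / β) ^ 2 - (l / β) ^ 2) (2 * (2 * (j : ℝ) + k / β))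
        (by nlinarith) m
      exact ⟨m, P, hm, hP, hPe⟩
  refine ⟨_, rpowLog_cos_mem_span_Tlog β j k l n P hkl hn hP, fun ρ θ hρ => ?_⟩
  rw [tLap_rpowLog_cos β _ P l hρ θ, hPe, rpowLog, tlogCos, sub_eq_neg_add, Real.rpow_add hρ]
  simp only [Polynomial.eval_pow, Polynomial.eval_X]
  ring
end

section
/- If η₁ ∈ Span(T_log) and η₂ ∈ Span(T_rhs), then the pointwise product η₁·η₂ belongs to Span(T_rhs). -/
open Real Set

/-- The functions agreeing on `ρ > 0` with an element of `Span(T_rhs)`. -/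
def rhsOnPos (β : ℝ) : Submodule ℝ (ℝ → ℝ → ℝ) where
  carrier := {g | ∃ ζ ∈ Submodule.span ℝ (Trhs β), ∀ ρ θ : ℝ, 0 < ρ → g ρ θ = ζ ρ θ}
  add_mem' := by
    rintro f g ⟨ζ, hζ, hf⟩ ⟨ξ, hξ, hg⟩
    exact ⟨ζ + ξ, add_mem hζ hξ, fun ρ θ h => by simp [hf ρ θ h, hg ρ θ h]⟩
  zero_mem' := ⟨0, zero_mem _, fun _ _ _ => rfl⟩
  smul_mem' := by
    rintro c f ⟨ζ, hζ, hf⟩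
    exact ⟨c • ζ, Submodule.smul_mem _ c hζ, fun ρ θ h => by simp [hf ρ θ h]⟩

theorem mem_rhsOnPos_of_mem_span {β : ℝ} {g : ℝ → ℝ → ℝ}
    (hg : g ∈ Submodule.span ℝ (Trhs β)) : g ∈ rhsOnPos β :=
  ⟨g, hg, fun _ _ _ => rfl⟩

theorem mem_rhsOnPos_congr {β : ℝ} {f g : ℝ → ℝ → ℝ} (hg : g ∈ rhsOnPos β)
    (h : ∀ ρ θ : ℝ, 0 < ρ → f ρ θ = g ρ θ) : f ∈ rhsOnPos β := by
  obtain ⟨ζ, hζ, hgζ⟩ := hg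
  exact ⟨ζ, hζ, fun ρ θ hρ => (h ρ θ hρ).trans (hgζ ρ θ hρ)⟩

theorem eq_and_eq_of_rpow_mul_log_pow_eq {a b c d : ℝ} {m n : ℕ} (hc : c ≠ 0)
    (h : ∀ ρ : ℝ, 0 < ρ → ρ ^ a * log ρ ^ m * c = ρ ^ b * log ρ ^ n * d) :
    a = b ∧ m = n := by
  have key (t : ℝ) : exp (t * (a - b)) * t ^ m * c = t ^ n * d := by
    have ht := h (exp t) (exp_pos t)
    rw [← exp_mul, ← exp_mul, log_exp] at ht
    have hb : exp (t * b) ≠ 0 := (exp_pos _).ne'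
    have hab : exp (t * a) = exp (t * (a - b)) * exp (t * b) := by
      rw [← exp_add]; ring_nf
    rw [hab] at ht
    apply mul_left_cancel₀ hb
    linarith
  have h1 := key 1
  have h2 := key (-1)
  simp only [one_pow, one_mul, mul_one] at h1
  have hinv : exp (a - b) * exp (-1 * (a - b)) = 1 := by
    rw [← exp_add]; simp
  have hr : exp (a - b) = 1 := by
    have hpos := exp_pos (a - b)
    have hsq : exp (a - b) ^ 2 = 1 := by
      have h3 : (-1 : ℝ) ^ m * c = (-1) ^ n * exp (a - b) ^ 2 * c := by
        calc (-1 : ℝ) ^ m * c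
            = exp (a - b) * (exp (-1 * (a - b)) * (-1) ^ m * c) := by
              linear_combination (-((-1 : ℝ) ^ m * c)) * hinv
          _ = (-1) ^ n * exp (a - b) ^ 2 * c := by rw [h2, ← h1]; ring
      have h4 := mul_right_cancel₀ hc h3
      have h5 := congrArg abs h4
      simpa [abs_mul] using h5.symm
    nlinarith
  have hab : a = b := by
    have := exp_eq_one_iff (a - b) |>.1 hr
    linarith
  refine ⟨hab, ?_⟩
  have h2' := key 2
  have hcd : c = d := by rw [hr, one_mul] at h1; exact h1
  rw [hab, sub_self, mul_zero, exp_zero, one_mul, ← hcd] at h2'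
  have h3 := mul_right_cancel₀ hc h2'
  exact pow_right_injective₀ (by norm_num : (0 : ℝ) < 2) (by norm_num) h3

theorem mem_Tlog_iff {β : ℝ} {f : ℝ → ℝ → ℝ} :
    f ∈ Tlog β ↔ ∃ j k m l : ℕ, TlogIdx j k m l ∧ ∃ T : ℝ → ℝ, (T = cos ∨ T = sin) ∧
      f = fun ρ θ => ρ ^ (2 * (j : ℝ) + (k : ℝ) / β) * log ρ ^ m * T (l * θ) := by
  constructor
  · rintro ⟨j, k, m, l, h, rfl | rfl⟩
    · exact ⟨j, k, m, l, h, cos, Or.inl rfl, rfl⟩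
    · exact ⟨j, k, m, l, h, sin, Or.inr rfl, rfl⟩
  · rintro ⟨j, k, m, l, h, T, rfl | rfl, rfl⟩
    · exact ⟨j, k, m, l, h, Or.inl rfl⟩
    · exact ⟨j, k, m, l, h, Or.inr rfl⟩

theorem mem_TrhsBad_iff {β : ℝ} {g : ℝ → ℝ → ℝ} :
    g ∈ TrhsBad β ↔ (g = fun ρ _ => ρ ^ (-2 : ℝ)) ∨
      ∃ k : ℕ, 0 < k ∧ ∃ T : ℝ → ℝ, (T = cos ∨ T = sin) ∧
        g = fun ρ θ => ρ ^ ((k : ℝ) / β - 2) * log ρ ^ (k - 1) * T (k * θ) := by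
  refine or_congr Iff.rfl (exists_congr fun k => and_congr_right fun _ => ?_)
  constructor
  · rintro (rfl | rfl)
    · exact ⟨cos, Or.inl rfl, rfl⟩
    · exact ⟨sin, Or.inr rfl, rfl⟩
  · rintro ⟨T, rfl | rfl, rfl⟩
    · exact Or.inl rfl
    · exact Or.inr rfl

theorem exists_trig_ne {T : ℝ → ℝ} (hT : T = cos ∨ T = sin) {k : ℕ} (hk : 0 < k) :
    ∃ θ : ℝ, T (k * θ) ≠ T (k * 0) := by
  have hk' : (k : ℝ) ≠ 0 := by positivity
  refine ⟨π / 2 / k, ?_⟩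
  rw [mul_div_cancel₀ _ hk']
  rcases hT with rfl | rfl <;> simp

theorem notMem_TrhsBad {β : ℝ} (hβ : 0 < β) {j k m l : ℕ} (hidx : TlogIdx j k m l)
    (hgood : 0 < j ∨ m + 1 < k) {T : ℝ → ℝ} {θ₀ : ℝ} (hθ₀ : T (l * θ₀) ≠ 0) :
    (fun ρ θ : ℝ => ρ ^ (-2 : ℝ) * (ρ ^ (2 * (j : ℝ) + (k : ℝ) / β) * log ρ ^ m * T (l * θ)))
      ∉ TrhsBad β := by
  obtain ⟨⟨i, hi⟩, hm⟩ := hidx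
  have hcomb (ρ : ℝ) (hρ : 0 < ρ) : ρ ^ (2 * (j : ℝ) + (k : ℝ) / β - 2)
      = ρ ^ (-2 : ℝ) * ρ ^ (2 * (j : ℝ) + (k : ℝ) / β) := by
    rw [← rpow_add hρ]; ring_nf
  rw [mem_TrhsBad_iff]
  rintro (h | ⟨k', hk', T', hT', h⟩)
  · obtain ⟨hab, -⟩ := eq_and_eq_of_rpow_mul_log_pow_eq (a := 2 * (j : ℝ) + (k : ℝ) / β - 2)
      (b := -2) (m := m) (n := 0) (d := 1) hθ₀ fun ρ hρ => by
        rw [hcomb ρ hρ]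
        have := congrFun (congrFun h ρ) θ₀
        linear_combination this
    have hkβ : 0 ≤ (k : ℝ) / β := by positivity
    have hj : (0 : ℝ) ≤ j := by positivity
    rcases hgood with hj' | hk
    · have : (0 : ℝ) < j := by exact_mod_cast hj'
      linarith
    · have : 0 < (k : ℝ) / β := div_pos (by exact_mod_cast (by omega : 0 < k)) hβ
      linarith
  · have heq (ρ θ : ℝ) (hρ : 0 < ρ) :
        ρ ^ (2 * (j : ℝ) + (k : ℝ) / β - 2) * log ρ ^ m * T (l * θ)
          = ρ ^ ((k' : ℝ) / β - 2) * log ρ ^ (k' - 1) * T' (k' * θ) := by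
      have := congrFun (congrFun h ρ) θ
      rw [hcomb ρ hρ]
      linear_combination this
    obtain ⟨hab, hmk⟩ := eq_and_eq_of_rpow_mul_log_pow_eq hθ₀ fun ρ hρ => heq ρ θ₀ hρ
    have hab' : 2 * (j : ℝ) * β + k = k' := by
      field_simp at hab
      linarith
    rcases Nat.eq_zero_or_pos j with rfl | hj
    · have : k = k' := by
        rw [Nat.cast_zero, mul_zero, zero_mul, zero_add] at hab'
        exact_mod_cast hab'
      omega
    · have hlt : k < k' := by
        have : (0 : ℝ) < 2 * (j : ℝ) * β := by positivity
        have : (k : ℝ) < k' := by linarith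
        exact_mod_cast this
      obtain rfl : k = 0 := by omega
      obtain rfl : l = 0 := by omega
      obtain ⟨θ, hθ⟩ := exists_trig_ne hT' hk'
      apply hθ
      have h1 := heq (exp 1) θ (exp_pos 1)
      have h2 := heq (exp 1) 0 (exp_pos 1)
      rw [Nat.cast_zero, zero_mul] at h1 h2
      have h3 := h1.symm.trans h2
      have hne : exp 1 ^ ((k' : ℝ) / β - 2) * log (exp 1) ^ (k' - 1) ≠ 0 := by
        rw [log_exp, one_pow, mul_one]
        exact (rpow_pos_of_pos (exp_pos 1) _).ne'
      exact mul_left_cancel₀ hne h3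

theorem mem_rhsOnPos_of_good {β : ℝ} (hβ : 0 < β) {j k m l : ℕ} (hidx : TlogIdx j k m l)
    (hgood : 0 < j ∨ m + 1 < k) {T : ℝ → ℝ} (hT : T = cos ∨ T = sin) :
    (fun ρ θ : ℝ => ρ ^ (-2 : ℝ) * (ρ ^ (2 * (j : ℝ) + (k : ℝ) / β) * log ρ ^ m * T (l * θ)))
      ∈ rhsOnPos β := by
  by_cases h0 : ∀ θ : ℝ, T (l * θ) = 0
  · simp only [h0, mul_zero]
    exact zero_mem _
  · push Not at h0
    obtain ⟨θ₀, hθ₀⟩ := h0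
    exact mem_rhsOnPos_of_mem_span <| Submodule.subset_span
      ⟨⟨_, mem_Tlog_iff.2 ⟨j, k, m, l, hidx, T, hT, rfl⟩, rfl⟩, notMem_TrhsBad hβ hidx hgood hθ₀⟩

theorem exists_trig_mul_eq_add {T₁ T₂ : ℝ → ℝ} (hT₁ : T₁ = cos ∨ T₁ = sin)
    (hT₂ : T₂ = cos ∨ T₂ = sin) (l₁ l₂ : ℕ) :
    ∃ T : ℝ → ℝ, (T = cos ∨ T = sin) ∧ ∃ (c d : ℝ) (l i : ℕ), l₁ + l₂ = l + 2 * i ∧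
      ∀ θ : ℝ, T₁ (l₁ * θ) * T₂ (l₂ * θ) = c * T ((l₁ + l₂ : ℕ) * θ) + d * T (l * θ) := by
  wlog hle : l₂ ≤ l₁ generalizing T₁ T₂ l₁ l₂
  · obtain ⟨T, hT, c, d, l, i, hl, h⟩ := this hT₂ hT₁ l₂ l₁ (by omega)
    refine ⟨T, hT, c, d, l, i, by omega, fun θ => ?_⟩
    rw [mul_comm, h, add_comm l₂ l₁]
  obtain ⟨n, rfl⟩ := Nat.exists_eq_add_of_le hle
  have hsum (θ : ℝ) : ((l₂ + n + l₂ : ℕ) : ℝ) * θ = (l₂ + n : ℕ) * θ + l₂ * θ := by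
    push_cast; ring
  have hdiff (θ : ℝ) : (n : ℝ) * θ = (l₂ + n : ℕ) * θ - l₂ * θ := by
    push_cast; ring
  rcases hT₁ with rfl | rfl <;> rcases hT₂ with rfl | rfl
  · refine ⟨cos, Or.inl rfl, 1 / 2, 1 / 2, n, l₂, by omega, fun θ => ?_⟩
    rw [hsum, hdiff, cos_add, cos_sub]; ring
  · refine ⟨sin, Or.inr rfl, 1 / 2, -1 / 2, n, l₂, by omega, fun θ => ?_⟩
    rw [hsum, hdiff, sin_add, sin_sub]; ring
  · refine ⟨sin, Or.inr rfl, 1 / 2, 1 / 2, n, l₂, by omega, fun θ => ?_⟩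
    rw [hsum, hdiff, sin_add, sin_sub]; ring
  · refine ⟨cos, Or.inl rfl, -1 / 2, 1 / 2, n, l₂, by omega, fun θ => ?_⟩
    rw [hsum, hdiff, cos_add, cos_sub]; ring

theorem mul_mem_rhsOnPos {β : ℝ} (hβ : 0 < β) {f g : ℝ → ℝ → ℝ} (hf : f ∈ Tlog β)
    (hg : g ∈ Trhs β) : f * g ∈ rhsOnPos β := by
  have hgR : g ∈ rhsOnPos β := mem_rhsOnPos_of_mem_span (Submodule.subset_span hg)
  obtain ⟨j₁, k₁, m₁, l₁, ⟨⟨i₁, hi₁⟩, hm₁⟩, T₁, hT₁, rfl⟩ := mem_Tlog_iff.1 hf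
  obtain ⟨⟨g', hg', rfl⟩, hbad⟩ := hg
  obtain ⟨j₂, k₂, m₂, l₂, ⟨⟨i₂, hi₂⟩, hm₂⟩, T₂, hT₂, rfl⟩ := mem_Tlog_iff.1 hg'
  by_cases h₁ : j₁ = 0 ∧ k₁ = 0
  · obtain ⟨rfl, rfl⟩ := h₁
    obtain rfl : l₁ = 0 := by omega
    obtain rfl : m₁ = 0 := by omega
    refine mem_rhsOnPos_congr (Submodule.smul_mem _ (T₁ 0) hgR) fun ρ θ _ => ?_
    simp
  by_cases h₂ : j₂ = 0 ∧ k₂ = 0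
  · obtain ⟨rfl, rfl⟩ := h₂
    obtain rfl : l₂ = 0 := by omega
    obtain rfl : m₂ = 0 := by omega
    rcases hT₂ with rfl | rfl
    · exact absurd (Or.inl (by ext; simp)) hbad
    · refine mem_rhsOnPos_congr (zero_mem _) fun ρ θ _ => ?_
      simp
  obtain ⟨T, hT, c, d, l, i, hl, hmul⟩ := exists_trig_mul_eq_add hT₁ hT₂ l₁ l₂
  have hgood : 0 < j₁ + j₂ ∨ m₁ + m₂ + 1 < k₁ + k₂ := by omega
  have hidx : TlogIdx (j₁ + j₂) (k₁ + k₂) (m₁ + m₂) (l₁ + l₂) :=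
    ⟨⟨i₁ + i₂, by omega⟩, by omega⟩
  have hidx' : TlogIdx (j₁ + j₂) (k₁ + k₂) (m₁ + m₂) l :=
    ⟨⟨i₁ + i₂ + i, by omega⟩, by omega⟩
  refine mem_rhsOnPos_congr (add_mem
    (Submodule.smul_mem _ c (mem_rhsOnPos_of_good hβ hidx hgood hT))
    (Submodule.smul_mem _ d (mem_rhsOnPos_of_good hβ hidx' hgood hT))) fun ρ θ hρ => ?_
  have hpow : ρ ^ (2 * ((j₁ + j₂ : ℕ) : ℝ) + ((k₁ + k₂ : ℕ) : ℝ) / β)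
      = ρ ^ (2 * (j₁ : ℝ) + (k₁ : ℝ) / β) * ρ ^ (2 * (j₂ : ℝ) + (k₂ : ℝ) / β) := by
    rw [← rpow_add hρ]; push_cast; ring_nf
  simp only [Pi.mul_apply, Pi.add_apply, Pi.smul_apply, smul_eq_mul, hpow]
  linear_combination ρ ^ (2 * (j₁ : ℝ) + (k₁ : ℝ) / β) * ρ ^ (2 * (j₂ : ℝ) + (k₂ : ℝ) / β) *
    ρ ^ (-2 : ℝ) * log ρ ^ m₁ * log ρ ^ m₂ * hmul θ

/-- if `η₁ ∈ Span(T_log)` and `η₂ ∈ Span(T_rhs)` then the pointwise product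
`η₁ · η₂` belongs to `Span(T_rhs)` (as functions on the domain `ρ > 0`). -/
theorem stmt4 (β : ℝ) (hβ0 : 0 < β) (hβ1 : β < 1)
    (η₁ η₂ : ℝ → ℝ → ℝ)
    (h1 : η₁ ∈ Submodule.span ℝ (Tlog β))
    (h2 : η₂ ∈ Submodule.span ℝ (Trhs β)) :
    ∃ ζ ∈ Submodule.span ℝ (Trhs β),
      ∀ ρ θ : ℝ, 0 < ρ → η₁ ρ θ * η₂ ρ θ = ζ ρ θ := by
  have hle : Submodule.span ℝ (Tlog β) * Submodule.span ℝ (Trhs β) ≤ rhsOnPos β := by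
    rw [Submodule.span_mul_span, Submodule.span_le]
    rintro _ ⟨f, hf, g, hg, rfl⟩
    exact mul_mem_rhsOnPos hβ0 hf hg
  exact hle (Submodule.mul_mem_mul h1 h2)
end

section
/- If f₁ and f₂ are elements of T_log, then the pointwise product f₁·f₂ belongs to Span(T_log); consequently Span(T_log) is closed under pointwise multiplication. -/
open Real Set

/-- Functions with a signed angular frequency `n` lie in the span of `T_log`
as soon as `|n|` is an admissible frequency. -/
lemma cos_int_mem_span_Tlog (β : ℝ) {j k m : ℕ} {n : ℤ} (h : TlogIdx j k m n.natAbs) :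
    (fun ρ θ : ℝ => ρ ^ (2 * (j : ℝ) + (k : ℝ) / β) * Real.log ρ ^ m * Real.cos (n * θ)) ∈
      Submodule.span ℝ (Tlog β) := by
  refine Submodule.subset_span ⟨j, k, m, n.natAbs, h, Or.inl ?_⟩
  funext ρ θ
  rcases Int.natAbs_eq n with hn | hn <;> rw [hn] <;> simp [tlogCos]

lemma sin_int_mem_span_Tlog (β : ℝ) {j k m : ℕ} {n : ℤ} (h : TlogIdx j k m n.natAbs) :
    (fun ρ θ : ℝ => ρ ^ (2 * (j : ℝ) + (k : ℝ) / β) * Real.log ρ ^ m * Real.sin (n * θ)) ∈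
      Submodule.span ℝ (Tlog β) := by
  have hmem : tlogSin β j k m n.natAbs ∈ Submodule.span ℝ (Tlog β) :=
    Submodule.subset_span ⟨j, k, m, n.natAbs, h, Or.inr rfl⟩
  rcases Int.natAbs_eq n with hn | hn
  · convert hmem using 3 with ρ θ
    rw [hn]
    simp [tlogSin]
  · convert Submodule.neg_mem _ hmem using 1
    funext ρ θ
    rw [hn]
    simp [tlogSin]

lemma TlogIdx.add {j₁ k₁ m₁ l₁ j₂ k₂ m₂ l₂ : ℕ} (h₁ : TlogIdx j₁ k₁ m₁ l₁)
    (h₂ : TlogIdx j₂ k₂ m₂ l₂) :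
    TlogIdx (j₁ + j₂) (k₁ + k₂) (m₁ + m₂) ((l₁ : ℤ) + l₂).natAbs := by
  obtain ⟨⟨i₁, hi₁⟩, hm₁⟩ := h₁
  obtain ⟨⟨i₂, hi₂⟩, hm₂⟩ := h₂
  exact ⟨⟨i₁ + i₂, by omega⟩, by omega⟩

lemma TlogIdx.sub {j₁ k₁ m₁ l₁ j₂ k₂ m₂ l₂ : ℕ} (h₁ : TlogIdx j₁ k₁ m₁ l₁)
    (h₂ : TlogIdx j₂ k₂ m₂ l₂) :
    TlogIdx (j₁ + j₂) (k₁ + k₂) (m₁ + m₂) ((l₁ : ℤ) - l₂).natAbs := by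
  obtain ⟨⟨i₁, hi₁⟩, hm₁⟩ := h₁
  obtain ⟨⟨i₂, hi₂⟩, hm₂⟩ := h₂
  exact ⟨⟨i₁ + i₂ + min l₁ l₂, by omega⟩, by omega⟩

lemma radial_mul (β : ℝ) (j₁ k₁ m₁ j₂ k₂ m₂ : ℕ) {ρ : ℝ} (hρ : 0 < ρ) :
    ρ ^ (2 * ((j₁ + j₂ : ℕ) : ℝ) + ((k₁ + k₂ : ℕ) : ℝ) / β) * Real.log ρ ^ (m₁ + m₂) =
      (ρ ^ (2 * (j₁ : ℝ) + (k₁ : ℝ) / β) * Real.log ρ ^ m₁) *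
        (ρ ^ (2 * (j₂ : ℝ) + (k₂ : ℝ) / β) * Real.log ρ ^ m₂) := by
  have h : 2 * ((j₁ + j₂ : ℕ) : ℝ) + ((k₁ + k₂ : ℕ) : ℝ) / β =
      (2 * (j₁ : ℝ) + (k₁ : ℝ) / β) + (2 * (j₂ : ℝ) + (k₂ : ℝ) / β) := by
    push_cast
    ring
  rw [h, Real.rpow_add hρ, pow_add]
  ring

lemma Tlog_mul (β : ℝ) {f₁ f₂ : ℝ → ℝ → ℝ} (hf₁ : f₁ ∈ Tlog β) (hf₂ : f₂ ∈ Tlog β) :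
    ∃ g ∈ Submodule.span ℝ (Tlog β),
      ∀ ρ θ : ℝ, 0 < ρ → f₁ ρ θ * f₂ ρ θ = g ρ θ := by
  obtain ⟨j₁, k₁, m₁, l₁, h₁, hf₁⟩ := hf₁
  obtain ⟨j₂, k₂, m₂, l₂, h₂, hf₂⟩ := hf₂
  have hca := cos_int_mem_span_Tlog β (h₁.add h₂)
  have hcs := cos_int_mem_span_Tlog β (h₁.sub h₂)
  have hsa := sin_int_mem_span_Tlog β (h₁.add h₂)
  have hss := sin_int_mem_span_Tlog β (h₁.sub h₂)
  rcases hf₁ with rfl | rfl <;> rcases hf₂ with rfl | rfl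
  · refine ⟨_, Submodule.smul_mem _ (1 / 2 : ℝ) (Submodule.add_mem _ hcs hca),
      fun ρ θ hρ => ?_⟩
    simp only [tlogCos, Pi.smul_apply, Pi.add_apply, smul_eq_mul,
      radial_mul β j₁ k₁ m₁ j₂ k₂ m₂ hρ, Int.cast_add, Int.cast_sub, Int.cast_natCast,
      add_mul _ _ θ, sub_mul _ _ θ, Real.cos_add, Real.cos_sub]
    ring
  · refine ⟨_, Submodule.smul_mem _ (1 / 2 : ℝ) (Submodule.sub_mem _ hsa hss),
      fun ρ θ hρ => ?_⟩
    simp only [tlogCos, tlogSin, Pi.smul_apply, Pi.sub_apply, smul_eq_mul,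
      radial_mul β j₁ k₁ m₁ j₂ k₂ m₂ hρ, Int.cast_add, Int.cast_sub, Int.cast_natCast,
      add_mul _ _ θ, sub_mul _ _ θ, Real.sin_add, Real.sin_sub]
    ring
  · refine ⟨_, Submodule.smul_mem _ (1 / 2 : ℝ) (Submodule.add_mem _ hsa hss),
      fun ρ θ hρ => ?_⟩
    simp only [tlogCos, tlogSin, Pi.smul_apply, Pi.add_apply, smul_eq_mul,
      radial_mul β j₁ k₁ m₁ j₂ k₂ m₂ hρ, Int.cast_add, Int.cast_sub, Int.cast_natCast,
      add_mul _ _ θ, sub_mul _ _ θ, Real.sin_add, Real.sin_sub]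
    ring
  · refine ⟨_, Submodule.smul_mem _ (1 / 2 : ℝ) (Submodule.sub_mem _ hcs hca),
      fun ρ θ hρ => ?_⟩
    simp only [tlogSin, Pi.smul_apply, Pi.sub_apply, smul_eq_mul,
      radial_mul β j₁ k₁ m₁ j₂ k₂ m₂ hρ, Int.cast_add, Int.cast_sub, Int.cast_natCast,
      add_mul _ _ θ, sub_mul _ _ θ, Real.cos_add, Real.cos_sub]
    ring

/-- the product of two elements of `T_log` lies in `Span(T_log)`;
consequently `Span(T_log)` is closed under pointwise multiplication
(as functions on the domain `ρ > 0`). -/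
theorem stmt6 (β : ℝ) (hβ0 : 0 < β) (hβ1 : β < 1) :
    (∀ f₁ ∈ Tlog β, ∀ f₂ ∈ Tlog β,
      ∃ g ∈ Submodule.span ℝ (Tlog β),
        ∀ ρ θ : ℝ, 0 < ρ → f₁ ρ θ * f₂ ρ θ = g ρ θ) ∧
    (∀ u₁ ∈ Submodule.span ℝ (Tlog β), ∀ u₂ ∈ Submodule.span ℝ (Tlog β),
      ∃ g ∈ Submodule.span ℝ (Tlog β),
        ∀ ρ θ : ℝ, 0 < ρ → u₁ ρ θ * u₂ ρ θ = g ρ θ) := by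
  refine ⟨fun f₁ hf₁ f₂ hf₂ => Tlog_mul β hf₁ hf₂, fun u₁ hu₁ u₂ hu₂ => ?_⟩
  induction hu₁, hu₂ using Submodule.span_induction₂ with
  | mem_mem f₁ f₂ hf₁ hf₂ => exact Tlog_mul β hf₁ hf₂
  | zero_left u hu => exact ⟨0, Submodule.zero_mem _, by simp⟩
  | zero_right u hu => exact ⟨0, Submodule.zero_mem _, by simp⟩
  | add_left u v w hu hv hw h h' =>
    obtain ⟨g, hg, e⟩ := h
    obtain ⟨g', hg', e'⟩ := h'
    exact ⟨g + g', Submodule.add_mem _ hg hg', fun ρ θ hρ => by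
      simp [add_mul, e ρ θ hρ, e' ρ θ hρ]⟩
  | add_right u v w hu hv hw h h' =>
    obtain ⟨g, hg, e⟩ := h
    obtain ⟨g', hg', e'⟩ := h'
    exact ⟨g + g', Submodule.add_mem _ hg hg', fun ρ θ hρ => by
      simp [mul_add, e ρ θ hρ, e' ρ θ hρ]⟩
  | smul_left c u v hu hv h =>
    obtain ⟨g, hg, e⟩ := h
    exact ⟨c • g, Submodule.smul_mem _ c hg, fun ρ θ hρ => by
      simp [mul_assoc, e ρ θ hρ]⟩
  | smul_right c u v hu hv h =>
    obtain ⟨g, hg, e⟩ := h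
    exact ⟨c • g, Submodule.smul_mem _ c hg, fun ρ θ hρ => by
      simp [mul_left_comm, e ρ θ hρ]⟩
end

section
/- Let q ≥ 0. If u₁ and u₂ are real-valued functions on (0,1/2) × ℝ (2π-periodic in θ) that each have an expansion up to order q, then the pointwise product u₁·u₂ has an expansion up to order q. -/
open Real Set

/-- Equality of two functions of `(ρ, θ)` on the strip `(0,1/2) × ℝ`. -/
def StripEq (u v : ℝ → ℝ → ℝ) : Prop :=
  ∀ ρ θ : ℝ, 0 < ρ → ρ < 1 / 2 → u ρ θ = v ρ θ

/-- Smoothness on the strip `(0,1/2) × ℝ`. -/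
def StripSmooth (u : ℝ → ℝ → ℝ) : Prop :=
  ContDiffOn ℝ (⊤ : ℕ∞) (Function.uncurry u) (Set.Ioo (0 : ℝ) (1 / 2) ×ˢ (Set.univ : Set ℝ))

theorem isOpen_strip : IsOpen (Set.Ioo (0 : ℝ) (1 / 2) ×ˢ (Set.univ : Set ℝ)) :=
  isOpen_Ioo.prod isOpen_univ

namespace StripSmooth

variable {u v : ℝ → ℝ → ℝ}

theorem congr (hu : StripSmooth u) (h : StripEq u v) : StripSmooth v :=
  ContDiffOn.congr hu fun p hp => (h p.1 p.2 hp.1.1 hp.1.2).symm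

theorem add (hu : StripSmooth u) (hv : StripSmooth v) : StripSmooth (u + v) :=
  ContDiffOn.add hu hv

theorem mul (hu : StripSmooth u) (hv : StripSmooth v) : StripSmooth (u * v) :=
  ContDiffOn.mul hu hv

theorem differentiableAt (hu : StripSmooth u) {ρ : ℝ} (θ : ℝ) (h0 : 0 < ρ) (h1 : ρ < 1 / 2) :
    DifferentiableAt ℝ (Function.uncurry u) (ρ, θ) :=
  (ContDiffOn.contDiffAt hu (isOpen_strip.mem_nhds ⟨⟨h0, h1⟩, trivial⟩)).differentiableAt
    (by simp)

theorem hasDerivAt_rho (hu : StripSmooth u) {ρ : ℝ} (θ : ℝ) (h0 : 0 < ρ) (h1 : ρ < 1 / 2) :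
    HasDerivAt (fun r => u r θ) (fderiv ℝ (Function.uncurry u) (ρ, θ) (1, 0)) ρ :=
  HasFDerivAt.comp_hasDerivAt (f := fun r : ℝ => (r, θ)) ρ
    (hu.differentiableAt θ h0 h1).hasFDerivAt ((hasDerivAt_id ρ).prodMk (hasDerivAt_const ρ θ))

theorem hasDerivAt_theta (hu : StripSmooth u) {ρ : ℝ} (θ : ℝ) (h0 : 0 < ρ) (h1 : ρ < 1 / 2) :
    HasDerivAt (fun t => u ρ t) (fderiv ℝ (Function.uncurry u) (ρ, θ) (0, 1)) θ :=
  (hu.differentiableAt θ h0 h1).hasFDerivAt.comp_hasDerivAt θ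
    ((hasDerivAt_const θ ρ).prodMk (hasDerivAt_id θ))

theorem contDiffOn_fderiv_apply (hu : StripSmooth u) (e : ℝ × ℝ) :
    ContDiffOn ℝ (⊤ : ℕ∞) (fun p => fderiv ℝ (Function.uncurry u) p e)
      (Set.Ioo (0 : ℝ) (1 / 2) ×ˢ (Set.univ : Set ℝ)) :=
  (ContDiffOn.fderiv_of_isOpen hu isOpen_strip (by simp)).clm_apply contDiffOn_const

theorem rhoDrho (hu : StripSmooth u) : StripSmooth (rhoDrho u) := by
  refine (contDiffOn_fst.mul (hu.contDiffOn_fderiv_apply (1, 0))).congr fun p hp => ?_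
  change p.1 * deriv (fun r => u r p.2) p.1 = _
  rw [(hu.hasDerivAt_rho p.2 hp.1.1 hp.1.2).deriv]

theorem pd_theta (hu : StripSmooth u) : StripSmooth (pd_theta u) := by
  refine (hu.contDiffOn_fderiv_apply (0, 1)).congr fun p hp => ?_
  change deriv (fun t => u p.1 t) p.2 = _
  rw [(hu.hasDerivAt_theta p.2 hp.1.1 hp.1.2).deriv]

end StripSmooth

/-- A derivation on smooth functions on the strip, whose values there depend only on the
restriction of its argument to the strip. -/
structure IsStripDerivation (L : (ℝ → ℝ → ℝ) → ℝ → ℝ → ℝ) : Prop where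
  smooth : ∀ u, StripSmooth u → StripSmooth (L u)
  congr : ∀ u v, StripEq u v → StripEq (L u) (L v)
  add : ∀ u v, StripSmooth u → StripSmooth v → StripEq (L (u + v)) (L u + L v)
  mul : ∀ u v, StripSmooth u → StripSmooth v → StripEq (L (u * v)) (L u * v + u * L v)

theorem isStripDerivation_rhoDrho : IsStripDerivation rhoDrho where
  smooth _ hu := hu.rhoDrho
  congr u v h ρ θ h0 h1 := by
    have : (fun r => u r θ) =ᶠ[nhds ρ] fun r => v r θ :=
      Filter.eventually_of_mem (Ioo_mem_nhds h0 h1) fun r hr => h r θ hr.1 hr.2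
    simp only [rhoDrho, this.deriv_eq]
  add u v hu hv ρ θ h0 h1 := by
    have hu' := (hu.hasDerivAt_rho θ h0 h1).differentiableAt
    have hv' := (hv.hasDerivAt_rho θ h0 h1).differentiableAt
    simp only [rhoDrho, Pi.add_apply, deriv_fun_add hu' hv']
    ring
  mul u v hu hv ρ θ h0 h1 := by
    have hu' := (hu.hasDerivAt_rho θ h0 h1).differentiableAt
    have hv' := (hv.hasDerivAt_rho θ h0 h1).differentiableAt
    simp only [rhoDrho, Pi.add_apply, Pi.mul_apply, deriv_fun_mul hu' hv']
    ring

theorem isStripDerivation_pd_theta : IsStripDerivation pd_theta where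
  smooth _ hu := hu.pd_theta
  congr u v h ρ θ h0 h1 := by
    have : (fun t => u ρ t) = fun t => v ρ t := funext fun t => h ρ t h0 h1
    simp only [pd_theta, this]
  add u v hu hv ρ θ h0 h1 := by
    have hu' := (hu.hasDerivAt_theta θ h0 h1).differentiableAt
    have hv' := (hv.hasDerivAt_theta θ h0 h1).differentiableAt
    simp only [pd_theta, Pi.add_apply, deriv_fun_add hu' hv']
  mul u v hu hv ρ θ h0 h1 := by
    have hu' := (hu.hasDerivAt_theta θ h0 h1).differentiableAt
    have hv' := (hv.hasDerivAt_theta θ h0 h1).differentiableAt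
    simp only [pd_theta, Pi.add_apply, Pi.mul_apply, deriv_fun_mul hu' hv']

namespace IsStripDerivation

variable {L : (ℝ → ℝ → ℝ) → ℝ → ℝ → ℝ} {u v : ℝ → ℝ → ℝ}

theorem iterate_congr (hL : IsStripDerivation L) (h : StripEq u v) (k : ℕ) :
    StripEq (L^[k] u) (L^[k] v) := by
  induction k generalizing u v with
  | zero => exact h
  | succ k ih => exact ih (hL.congr u v h)

theorem iterate_add (hL : IsStripDerivation L) (hu : StripSmooth u) (hv : StripSmooth v) (k : ℕ) :
    StripEq (L^[k] (u + v)) (L^[k] u + L^[k] v) := by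
  induction k generalizing u v with
  | zero => exact fun _ _ _ _ => rfl
  | succ k ih =>
    intro ρ θ h0 h1
    exact (hL.iterate_congr (hL.add u v hu hv) k ρ θ h0 h1).trans
      (ih (hL.smooth u hu) (hL.smooth v hv) ρ θ h0 h1)

theorem iterate_smooth (hL : IsStripDerivation L) (hu : StripSmooth u) (k : ℕ) :
    StripSmooth (L^[k] u) := by
  induction k generalizing u with
  | zero => exact hu
  | succ k ih => exact ih (hL.smooth u hu)

end IsStripDerivation

theorem StripEq.symm {u v : ℝ → ℝ → ℝ} (h : StripEq u v) : StripEq v u :=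
  fun ρ θ h0 h1 => (h ρ θ h0 h1).symm

/-- A class of smooth functions on the strip that depends only on restrictions to the strip and is
closed under addition. -/
structure IsStripClass (P : (ℝ → ℝ → ℝ) → Prop) : Prop where
  smooth : ∀ u, P u → StripSmooth u
  congr : ∀ u v, StripEq u v → P u → P v
  add : ∀ u v, P u → P v → P (u + v)

/-- The functions all of whose iterates under `L` belong to `P`. -/
def IterClass (P : (ℝ → ℝ → ℝ) → Prop) (L : (ℝ → ℝ → ℝ) → ℝ → ℝ → ℝ) (u : ℝ → ℝ → ℝ) : Prop :=
  ∀ k : ℕ, P (L^[k] u)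

namespace IterClass

variable {P Q R : (ℝ → ℝ → ℝ) → Prop} {L : (ℝ → ℝ → ℝ) → ℝ → ℝ → ℝ} {u v : ℝ → ℝ → ℝ}

theorem apply (h : IterClass P L u) : IterClass P L (L u) := fun k => h (k + 1)

theorem mono (hPQ : ∀ w, P w → Q w) (h : IterClass P L u) : IterClass Q L u :=
  fun k => hPQ _ (h k)

theorem isStripClass (hP : IsStripClass P) (hL : IsStripDerivation L) :
    IsStripClass (IterClass P L) where
  smooth u hu := hP.smooth u (hu 0)
  congr _ _ h hu k := hP.congr _ _ (hL.iterate_congr h k) (hu k)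
  add _ _ hu hv k :=
    hP.congr _ _ (hL.iterate_add (hP.smooth _ (hu 0)) (hP.smooth _ (hv 0)) k).symm
      (hP.add _ _ (hu k) (hv k))

theorem mul (hP : IsStripClass P) (hQ : IsStripClass Q) (hR : IsStripClass R)
    (hL : IsStripDerivation L) (hmul : ∀ u v, P u → Q v → R (u * v))
    (hu : IterClass P L u) (hv : IterClass Q L v) : IterClass R L (u * v) := by
  intro k
  induction k generalizing u v with
  | zero => exact hmul _ _ (hu 0) (hv 0)
  | succ k ih =>
    have su := hP.smooth _ (hu 0)
    have sv := hQ.smooth _ (hv 0)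
    have h := hL.iterate_congr (hL.mul u v su sv) k
    have h' := hL.iterate_add ((hL.smooth u su).mul sv) (su.mul (hL.smooth v sv)) k
    exact hR.congr _ _ h.symm (hR.congr _ _ h'.symm
      (hR.add _ _ (ih hu.apply hv) (ih hu hv.apply)))

theorem of_invariant (hP : IsStripClass P) (hL : IsStripDerivation L) {S : Set (ℝ → ℝ → ℝ)}
    (hS : ∀ w ∈ S, P w) (hinv : ∀ w ∈ S, ∃ w' ∈ S, StripEq w' (L w)) (hu : u ∈ S) :
    IterClass P L u := by
  intro k
  induction k generalizing u with
  | zero => exact hS u hu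
  | succ k ih =>
    obtain ⟨w, hw, h⟩ := hinv u hu
    exact hP.congr _ _ (hL.iterate_congr h k) (ih hw)

end IterClass

/-- Smooth functions on the strip bounded by a multiple of `ρ ^ q`. -/
def WeightBound (q : ℝ) (u : ℝ → ℝ → ℝ) : Prop :=
  StripSmooth u ∧ ∃ C : ℝ, ∀ ρ θ : ℝ, 0 < ρ → ρ < 1 / 2 → |u ρ θ| ≤ C * ρ ^ q

/-- The estimates and smoothness in the definition of `Õ(q)`, without periodicity. -/
def ConormalBound (q : ℝ) : (ℝ → ℝ → ℝ) → Prop :=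
  IterClass (IterClass (WeightBound q) rhoDrho) pd_theta

theorem WeightBound.isStripClass (q : ℝ) : IsStripClass (WeightBound q) where
  smooth u hu := hu.1
  congr u v h hu := by
    obtain ⟨hs, C, hC⟩ := hu
    exact ⟨hs.congr h, C, fun ρ θ h0 h1 => h ρ θ h0 h1 ▸ hC ρ θ h0 h1⟩
  add u v hu hv := by
    obtain ⟨hs, C, hC⟩ := hu
    obtain ⟨ht, D, hD⟩ := hv
    refine ⟨hs.add ht, C + D, fun ρ θ h0 h1 => ?_⟩
    rw [add_mul]
    exact (abs_add_le _ _).trans (add_le_add (hC ρ θ h0 h1) (hD ρ θ h0 h1))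

theorem WeightBound.mul {a b : ℝ} {u v : ℝ → ℝ → ℝ} (hu : WeightBound a u)
    (hv : WeightBound b v) : WeightBound (a + b) (u * v) := by
  obtain ⟨hs, C, hC⟩ := hu
  obtain ⟨ht, D, hD⟩ := hv
  refine ⟨hs.mul ht, C * D, fun ρ θ h0 h1 => ?_⟩
  have hm := mul_le_mul (hC ρ θ h0 h1) (hD ρ θ h0 h1) (abs_nonneg _)
    ((abs_nonneg _).trans (hC ρ θ h0 h1))
  rw [Real.rpow_add h0, Pi.mul_apply, Pi.mul_apply, abs_mul]
  linarith

theorem WeightBound.mono {a b : ℝ} (hab : a ≤ b) {u : ℝ → ℝ → ℝ} (hu : WeightBound b u) :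
    WeightBound a u := by
  obtain ⟨hs, C, hC⟩ := hu
  refine ⟨hs, |C|, fun ρ θ h0 h1 => (hC ρ θ h0 h1).trans ?_⟩
  exact mul_le_mul (le_abs_self C)
    (Real.rpow_le_rpow_of_exponent_ge h0 (by linarith) hab) (by positivity) (abs_nonneg C)

namespace ConormalBound

variable {a b q : ℝ} {u v : ℝ → ℝ → ℝ}

theorem isStripClass_radial (q : ℝ) : IsStripClass (IterClass (WeightBound q) rhoDrho) :=
  IterClass.isStripClass (WeightBound.isStripClass q) isStripDerivation_rhoDrho

theorem isStripClass (q : ℝ) : IsStripClass (ConormalBound q) :=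
  IterClass.isStripClass (isStripClass_radial q) isStripDerivation_pd_theta

theorem mul (hu : ConormalBound a u) (hv : ConormalBound b v) : ConormalBound (a + b) (u * v) :=
  IterClass.mul (isStripClass_radial a) (isStripClass_radial b) (isStripClass_radial (a + b))
    isStripDerivation_pd_theta
    (fun _ _ hs ht => IterClass.mul (WeightBound.isStripClass a) (WeightBound.isStripClass b)
      (WeightBound.isStripClass (a + b)) isStripDerivation_rhoDrho (fun _ _ => WeightBound.mul)
      hs ht) hu hv

theorem mul_zero_weight (hu : ConormalBound 0 u) (hv : ConormalBound 0 v) :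
    ConormalBound 0 (u * v) := by
  simpa using hu.mul hv

theorem mono (hab : a ≤ b) (hu : ConormalBound b u) : ConormalBound a u :=
  IterClass.mono (fun _ hw => IterClass.mono (fun _ => WeightBound.mono hab) hw) hu

theorem of_oTilde (hu : OTilde q u) : ConormalBound q u := fun k j =>
  ⟨isStripDerivation_rhoDrho.iterate_smooth (isStripDerivation_pd_theta.iterate_smooth hu.1 k) j,
    hu.2.2 j k⟩

theorem oTilde (hu : ConormalBound q u)
    (hper : ∀ ρ θ : ℝ, u ρ (θ + 2 * Real.pi) = u ρ θ) : OTilde q u :=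
  ⟨(isStripClass q).smooth u hu, hper, fun k1 k2 => (hu k2 k1).2⟩

end ConormalBound

/-- Products of a combination of `ρ^ε log ρ` and `ρ^ε` with a trigonometric function of
frequency `l`. -/
noncomputable def logTrig (ε l x y c d : ℝ) : ℝ → ℝ → ℝ := fun ρ θ =>
  (x * (ρ ^ ε * Real.log ρ) + y * ρ ^ ε) * (c * Real.cos (l * θ) + d * Real.sin (l * θ))

theorem rhoDrho_logTrig (ε l x y c d : ℝ) :
    StripEq (logTrig ε l (ε * x) (x + ε * y) c d) (rhoDrho (logTrig ε l x y c d)) := by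
  intro ρ θ h0 _
  have hp : HasDerivAt (fun r : ℝ => r ^ ε) (ε * ρ ^ (ε - 1)) ρ :=
    Real.hasDerivAt_rpow_const (Or.inl h0.ne')
  have h := ((((hp.mul (Real.hasDerivAt_log h0.ne')).const_mul x).add (hp.const_mul y)).mul_const
    (c * Real.cos (l * θ) + d * Real.sin (l * θ))).deriv
  have e : ρ ^ (ε - 1) = ρ ^ ε / ρ := by rw [Real.rpow_sub h0, Real.rpow_one]
  rw [e] at h
  change _ = ρ * deriv _ ρ
  refine Eq.trans ?_ (congrArg (ρ * ·) h.symm)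
  simp only [logTrig]
  field_simp
  ring

theorem pd_theta_logTrig (ε l x y c d : ℝ) :
    StripEq (logTrig ε l x y (l * d) (-(l * c))) (pd_theta (logTrig ε l x y c d)) := by
  intro ρ θ _ _
  have hl : HasDerivAt (fun t : ℝ => l * t) l θ := by
    simpa using (hasDerivAt_id θ).const_mul l
  have h := (((hl.cos.const_mul c).add (hl.sin.const_mul d)).const_mul
    (x * (ρ ^ ε * Real.log ρ) + y * ρ ^ ε)).deriv
  refine Eq.trans ?_ h.symm
  simp only [logTrig]
  ring

theorem stripSmooth_logTrig (ε l x y c d : ℝ) : StripSmooth (logTrig ε l x y c d) := by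
  have hne : ∀ p ∈ Set.Ioo (0 : ℝ) (1 / 2) ×ˢ (Set.univ : Set ℝ), p.1 ≠ 0 :=
    fun p hp => hp.1.1.ne'
  have hp : ContDiffOn ℝ (⊤ : ℕ∞) (fun p : ℝ × ℝ => p.1 ^ ε)
      (Set.Ioo (0 : ℝ) (1 / 2) ×ˢ (Set.univ : Set ℝ)) :=
    contDiffOn_fst.rpow_const_of_ne hne
  have hlog : ContDiffOn ℝ (⊤ : ℕ∞) (fun p : ℝ × ℝ => Real.log p.1)
      (Set.Ioo (0 : ℝ) (1 / 2) ×ˢ (Set.univ : Set ℝ)) :=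
    contDiffOn_fst.log hne
  have htrig : ContDiff ℝ (⊤ : ℕ∞)
      (fun p : ℝ × ℝ => c * Real.cos (l * p.2) + d * Real.sin (l * p.2)) := by
    fun_prop
  exact ((contDiffOn_const.mul (hp.mul hlog)).add (contDiffOn_const.mul hp)).mul htrig.contDiffOn

theorem weightBound_logTrig {ε l x y c d : ℝ} (hε : 0 ≤ ε) (hx : x = 0 ∨ 0 < ε) :
    WeightBound 0 (logTrig ε l x y c d) := by
  refine ⟨stripSmooth_logTrig ε l x y c d,
    (|x| * (1 / ε) + |y|) * (|c| + |d|), fun ρ θ h0 h1 => ?_⟩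
  rw [Real.rpow_zero, mul_one, logTrig, abs_mul]
  have hle : ρ ≤ 1 := by linarith
  have hpow : |ρ ^ ε| ≤ 1 := by
    rw [abs_of_pos (Real.rpow_pos_of_pos h0 ε)]
    exact Real.rpow_le_one h0.le hle hε
  have hlog : |x * (ρ ^ ε * Real.log ρ)| ≤ |x| * (1 / ε) := by
    rcases hx with rfl | hε'
    · simp
    · rw [abs_mul, mul_comm (ρ ^ ε)]
      exact mul_le_mul_of_nonneg_left (Real.abs_log_mul_self_rpow_lt ρ ε h0 hle hε').le
        (abs_nonneg x)
  have hy : |y * ρ ^ ε| ≤ |y| := by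
    rw [abs_mul]; exact mul_le_of_le_one_right (abs_nonneg y) hpow
  have hc : |c * Real.cos (l * θ)| ≤ |c| := by
    rw [abs_mul]; exact mul_le_of_le_one_right (abs_nonneg c) (Real.abs_cos_le_one _)
  have hd : |d * Real.sin (l * θ)| ≤ |d| := by
    rw [abs_mul]; exact mul_le_of_le_one_right (abs_nonneg d) (Real.abs_sin_le_one _)
  have hA := (abs_add_le _ _).trans (add_le_add hlog hy)
  exact mul_le_mul hA ((abs_add_le _ _).trans (add_le_add hc hd)) (abs_nonneg _)
    ((abs_nonneg _).trans hA)

theorem conormalBound_logTrig {ε l x y c d : ℝ} (hε : 0 ≤ ε) (hx : x = 0 ∨ 0 < ε) :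
    ConormalBound 0 (logTrig ε l x y c d) := by
  let S : Set (ℝ → ℝ → ℝ) :=
    {w | ∃ x y c d : ℝ, (x = 0 ∨ 0 < ε) ∧ w = logTrig ε l x y c d}
  refine IterClass.of_invariant (S := S) (ConormalBound.isStripClass_radial 0)
    isStripDerivation_pd_theta (fun w hw => IterClass.of_invariant (S := S)
      (WeightBound.isStripClass 0) isStripDerivation_rhoDrho ?_ ?_ hw) ?_
    ⟨x, y, c, d, hx, rfl⟩
  · rintro _ ⟨x, y, c, d, hx, rfl⟩
    exact weightBound_logTrig hε hx
  · rintro _ ⟨x, y, c, d, hx, rfl⟩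
    exact ⟨_, ⟨ε * x, x + ε * y, c, d, hx.imp (by rintro rfl; simp) id, rfl⟩,
      rhoDrho_logTrig ε l x y c d⟩
  · rintro _ ⟨x, y, c, d, hx, rfl⟩
    exact ⟨_, ⟨x, y, l * d, -(l * c), hx, rfl⟩, pd_theta_logTrig ε l x y c d⟩

theorem conormalBound_rpow_mul_log_pow {a : ℝ} (ha : 0 ≤ a) (l c d : ℝ) (m : ℕ)
    (hm : m = 0 ∨ 0 < a) :
    ConormalBound 0 (fun ρ θ => ρ ^ a * Real.log ρ ^ m *
      (c * Real.cos (l * θ) + d * Real.sin (l * θ))) := by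
  induction m generalizing a with
  | zero =>
    refine (ConormalBound.isStripClass 0).congr _ _ ?_
      (conormalBound_logTrig (l := l) (x := 0) (y := 1) (c := c) (d := d) ha (Or.inl rfl))
    intro ρ θ _ _
    simp [logTrig]
  | succ m ih =>
    have ha' : 0 < a := hm.resolve_left (Nat.succ_ne_zero m)
    refine (ConormalBound.isStripClass 0).congr _ _ ?_
      ((ih (half_pos ha').le (Or.inr (half_pos ha'))).mul_zero_weight
        (conormalBound_logTrig (l := 0) (x := 1) (y := 0) (c := 1) (d := 0) (half_pos ha').le
          (Or.inr (half_pos ha'))))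
    intro ρ θ h0 _
    have e : ρ ^ a = ρ ^ (a / 2) * ρ ^ (a / 2) := by rw [← Real.rpow_add h0, add_halves]
    simp only [Pi.mul_apply, logTrig, e, zero_mul, Real.cos_zero, Real.sin_zero]
    ring

theorem conormalBound_of_mem_span {β : ℝ} (hβ : 0 < β) {η : ℝ → ℝ → ℝ}
    (h : η ∈ Submodule.span ℝ (Tlog β)) : ConormalBound 0 η := by
  induction h using Submodule.span_induction with
  | mem f hf =>
    obtain ⟨j, k, m, l, ⟨-, hm⟩, hf⟩ := hf
    have ha : 0 ≤ 2 * (j : ℝ) + (k : ℝ) / β := by positivity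
    have hma : m = 0 ∨ 0 < 2 * (j : ℝ) + (k : ℝ) / β := by
      rcases Nat.eq_zero_or_pos k with rfl | hk
      · left; simpa using hm
      · right; positivity
    rcases hf with rfl | rfl
    · refine (ConormalBound.isStripClass 0).congr _ _ (fun ρ θ _ _ => ?_)
        (conormalBound_rpow_mul_log_pow ha l 1 0 m hma)
      simp [tlogCos]
    · refine (ConormalBound.isStripClass 0).congr _ _ (fun ρ θ _ _ => ?_)
        (conormalBound_rpow_mul_log_pow ha l 0 1 m hma)
      simp [tlogSin]
  | zero =>
    refine (ConormalBound.isStripClass 0).congr _ _ ?_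
      (conormalBound_logTrig (l := 0) (y := 0) (c := 0) (d := 0) le_rfl (Or.inl rfl))
    intro ρ θ _ _
    simp [logTrig]
  | add f g _ _ hf hg => exact (ConormalBound.isStripClass 0).add f g hf hg
  | smul r f _ hf =>
    refine (ConormalBound.isStripClass 0).congr _ _ ?_
      ((conormalBound_logTrig (l := 0) (y := r) (c := 1) (d := 0) le_rfl
        (Or.inl rfl)).mul_zero_weight hf)
    intro ρ θ _ _
    simp [logTrig]

theorem periodic_of_mem_span {β : ℝ} {η : ℝ → ℝ → ℝ}
    (h : η ∈ Submodule.span ℝ (Tlog β)) (ρ θ : ℝ) : η ρ (θ + 2 * Real.pi) = η ρ θ := by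
  induction h using Submodule.span_induction with
  | mem f hf =>
    obtain ⟨j, k, m, l, -, rfl | rfl⟩ := hf
    · simp only [tlogCos, mul_add, Real.cos_add_nat_mul_two_pi]
    · simp only [tlogSin, mul_add, Real.sin_add_nat_mul_two_pi]
  | zero => rfl
  | add f g _ _ hf hg => simp only [Pi.add_apply, hf, hg]
  | smul r f _ hf => simp only [Pi.smul_apply, hf]

theorem trig_int_mem_span (β : ℝ) {j k m : ℕ} {n : ℤ} (hn : ∃ i : ℕ, k = n.natAbs + 2 * i)
    (hm : m ≤ k - 1) (c d : ℝ) :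
    (fun ρ θ : ℝ => ρ ^ (2 * (j : ℝ) + (k : ℝ) / β) * Real.log ρ ^ m *
      (c * Real.cos (n * θ) + d * Real.sin (n * θ))) ∈ Submodule.span ℝ (Tlog β) := by
  have hidx : TlogIdx j k m n.natAbs := ⟨hn, le_max_of_le_right hm⟩
  have hc : tlogCos β j k m n.natAbs ∈ Submodule.span ℝ (Tlog β) :=
    Submodule.subset_span ⟨j, k, m, n.natAbs, hidx, Or.inl rfl⟩
  have hs : tlogSin β j k m n.natAbs ∈ Submodule.span ℝ (Tlog β) :=
    Submodule.subset_span ⟨j, k, m, n.natAbs, hidx, Or.inr rfl⟩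
  rcases Int.natAbs_eq n with h | h
  · convert Submodule.add_mem _ (Submodule.smul_mem _ c hc) (Submodule.smul_mem _ d hs) using 1
    funext ρ θ
    have hr : (n : ℝ) = (n.natAbs : ℝ) := congrArg (Int.cast : ℤ → ℝ) h
    simp only [tlogCos, tlogSin, Pi.add_apply, Pi.smul_apply, smul_eq_mul, hr]
    ring
  · convert Submodule.add_mem _ (Submodule.smul_mem _ c hc) (Submodule.smul_mem _ (-d) hs) using 1
    funext ρ θ
    have hr : (n : ℝ) = -(n.natAbs : ℝ) := by simpa using congrArg (Int.cast : ℤ → ℝ) h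
    simp only [tlogCos, tlogSin, Pi.add_apply, Pi.smul_apply, smul_eq_mul, hr, neg_mul,
      Real.cos_neg, Real.sin_neg]
    ring

theorem exists_mem_span_mul_of_mem_Tlog {β : ℝ} {f g : ℝ → ℝ → ℝ} (hf : f ∈ Tlog β)
    (hg : g ∈ Tlog β) : ∃ ζ ∈ Submodule.span ℝ (Tlog β), StripEq (f * g) ζ := by
  obtain ⟨j, k, m, l, ⟨⟨i, hi⟩, hm⟩, hf⟩ := hf
  obtain ⟨j', k', m', l', ⟨⟨i', hi'⟩, hm'⟩, hg⟩ := hg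
  rw [Nat.zero_max] at hm hm'
  have hmm : m + m' ≤ (k + k') - 1 := by omega
  have key (c d c' d' : ℝ) := Submodule.add_mem _
    (trig_int_mem_span β (j := j + j') (n := (l : ℤ) - l')
      (⟨(k + k' - ((l : ℤ) - l').natAbs) / 2, by omega⟩) hmm c d)
    (trig_int_mem_span β (j := j + j') (n := (l : ℤ) + l')
      (⟨i + i', by omega⟩) hmm c' d')
  have hpow {ρ : ℝ} (h0 : 0 < ρ) :
      ρ ^ (2 * ((j + j' : ℕ) : ℝ) + ((k + k' : ℕ) : ℝ) / β) =
        ρ ^ (2 * (j : ℝ) + (k : ℝ) / β) * ρ ^ (2 * (j' : ℝ) + (k' : ℝ) / β) := by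
    rw [← Real.rpow_add h0]
    push_cast
    ring_nf
  rcases hf with rfl | rfl <;> rcases hg with rfl | rfl
  · refine ⟨_, key (1 / 2) 0 (1 / 2) 0, fun ρ θ h0 _ => ?_⟩
    simp only [Pi.mul_apply, Pi.add_apply, tlogCos, hpow h0, Int.cast_sub, Int.cast_add,
      Int.cast_natCast, sub_mul, add_mul, Real.cos_sub, Real.cos_add]
    ring
  · refine ⟨_, key 0 (-1 / 2) 0 (1 / 2), fun ρ θ h0 _ => ?_⟩
    simp only [Pi.mul_apply, Pi.add_apply, tlogCos, tlogSin, hpow h0, Int.cast_sub, Int.cast_add,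
      Int.cast_natCast, sub_mul, add_mul, Real.sin_sub, Real.sin_add]
    ring
  · refine ⟨_, key 0 (1 / 2) 0 (1 / 2), fun ρ θ h0 _ => ?_⟩
    simp only [Pi.mul_apply, Pi.add_apply, tlogCos, tlogSin, hpow h0, Int.cast_sub, Int.cast_add,
      Int.cast_natCast, sub_mul, add_mul, Real.sin_sub, Real.sin_add]
    ring
  · refine ⟨_, key (1 / 2) 0 (-1 / 2) 0, fun ρ θ h0 _ => ?_⟩
    simp only [Pi.mul_apply, Pi.add_apply, tlogSin, hpow h0, Int.cast_sub, Int.cast_add,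
      Int.cast_natCast, sub_mul, add_mul, Real.cos_sub, Real.cos_add]
    ring

theorem exists_mem_span_mul {β : ℝ} {η₁ η₂ : ℝ → ℝ → ℝ}
    (h₁ : η₁ ∈ Submodule.span ℝ (Tlog β)) (h₂ : η₂ ∈ Submodule.span ℝ (Tlog β)) :
    ∃ ζ ∈ Submodule.span ℝ (Tlog β), StripEq (η₁ * η₂) ζ := by
  induction h₁, h₂ using Submodule.span_induction₂ with
  | mem_mem f g hf hg => exact exists_mem_span_mul_of_mem_Tlog hf hg
  | zero_left g _ => exact ⟨0, Submodule.zero_mem _, fun ρ θ _ _ => by simp⟩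
  | zero_right f _ => exact ⟨0, Submodule.zero_mem _, fun ρ θ _ _ => by simp⟩
  | add_left f g e _ _ _ hf hg =>
    obtain ⟨ζ, hζ, h⟩ := hf
    obtain ⟨ξ, hξ, h'⟩ := hg
    refine ⟨ζ + ξ, Submodule.add_mem _ hζ hξ, fun ρ θ h0 h1 => ?_⟩
    rw [add_mul, Pi.add_apply, Pi.add_apply, Pi.add_apply, Pi.add_apply, h ρ θ h0 h1,
      h' ρ θ h0 h1]
  | add_right f g e _ _ _ hf hg =>
    obtain ⟨ζ, hζ, h⟩ := hf
    obtain ⟨ξ, hξ, h'⟩ := hg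
    refine ⟨ζ + ξ, Submodule.add_mem _ hζ hξ, fun ρ θ h0 h1 => ?_⟩
    rw [mul_add, Pi.add_apply, Pi.add_apply, Pi.add_apply, Pi.add_apply, h ρ θ h0 h1,
      h' ρ θ h0 h1]
  | smul_left r f g _ _ hf =>
    obtain ⟨ζ, hζ, h⟩ := hf
    refine ⟨r • ζ, Submodule.smul_mem _ r hζ, fun ρ θ h0 h1 => ?_⟩
    rw [smul_mul_assoc, Pi.smul_apply, Pi.smul_apply, Pi.smul_apply, Pi.smul_apply, h ρ θ h0 h1]
  | smul_right r f g _ _ hf =>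
    obtain ⟨ζ, hζ, h⟩ := hf
    refine ⟨r • ζ, Submodule.smul_mem _ r hζ, fun ρ θ h0 h1 => ?_⟩
    rw [mul_smul_comm, Pi.smul_apply, Pi.smul_apply, Pi.smul_apply, Pi.smul_apply, h ρ θ h0 h1]

/-- the product of two functions with expansion up to order `q ≥ 0`
has an expansion up to order `q`. -/
theorem stmt12 (β : ℝ) (hβ0 : 0 < β) (hβ1 : β < 1) (q : ℝ) (hq : 0 ≤ q)
    (u₁ u₂ : ℝ → ℝ → ℝ)
    (h1 : HasExpansion β q u₁) (h2 : HasExpansion β q u₂) :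
    HasExpansion β q (fun ρ θ => u₁ ρ θ * u₂ ρ θ) := by
  obtain ⟨η₁, hη₁, hw₁⟩ := h1
  obtain ⟨η₂, hη₂, hw₂⟩ := h2
  obtain ⟨ζ, hζ, hmul⟩ := exists_mem_span_mul hη₁ hη₂
  have b₁ := conormalBound_of_mem_span hβ0 hη₁
  have b₂ := conormalBound_of_mem_span hβ0 hη₂
  have c₁ := ConormalBound.of_oTilde hw₁
  have c₂ := ConormalBound.of_oTilde hw₂
  have key : ConormalBound q (fun ρ θ => u₁ ρ θ * u₂ ρ θ - ζ ρ θ) := by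
    have t₁ := c₁.mul ((ConormalBound.isStripClass 0).add _ _ (c₂.mono hq) b₂)
    have t₂ := b₁.mul c₂
    rw [add_zero] at t₁
    rw [zero_add] at t₂
    refine (ConormalBound.isStripClass q).congr _ _ ?_
      ((ConormalBound.isStripClass q).add _ _ t₁ t₂)
    intro ρ θ h0 h1
    simp only [← hmul ρ θ h0 h1, Pi.add_apply, Pi.mul_apply]
    ring
  refine ⟨ζ, hζ, key.oTilde fun ρ θ => ?_⟩
  have p₁ := hw₁.2.1 ρ θ
  have p₂ := hw₂.2.1 ρ θ
  simp only [periodic_of_mem_span hη₁, periodic_of_mem_span hη₂, sub_left_inj] at p₁ p₂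
  rw [p₁, p₂, periodic_of_mem_span hζ]
end

section
/- Let N ≥ 1 and let F : ℝ^N → ℝ be a smooth function. Let q ≥ 0 and suppose u₁, …, u_N are real-valued functions on (0,1/2) × ℝ (2π-periodic in θ) that each have an expansion up to order q. Then the composite function (ρ,θ) ↦ F(u₁(ρ,θ), …, u_N(ρ,θ)) has an expansion up to order q. -/
open Real Set

/-- An integral over a compact interval depends on its parameter as smoothly as the integrand. -/
theorem contDiff_nat_parametric_intervalIntegral {E : Type} [NormedAddCommGroup E]
    [NormedSpace ℝ E] [FiniteDimensional ℝ E] (n : ℕ) :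
    ∀ {G : Type} [NormedAddCommGroup G] [NormedSpace ℝ G] [CompleteSpace G] {f : E → ℝ → G},
      ContDiff ℝ n (Function.uncurry f) → ContDiff ℝ n (fun x => ∫ t in (0 : ℝ)..1, f x t) := by
  induction n with
  | zero =>
    intro G _ _ _ f hf
    rw [Nat.cast_zero, contDiff_zero] at hf ⊢
    exact intervalIntegral.continuous_parametric_intervalIntegral_of_continuous' hf 0 1
  | succ n ih =>
    intro G _ _ _ f hf
    set f' : E → ℝ → E →L[ℝ] G := fun x t =>
      (fderiv ℝ (Function.uncurry f) (x, t)).comp (ContinuousLinearMap.inl ℝ E ℝ) with hf'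
    have hn : (n : WithTop ℕ∞) + 1 ≤ ((n + 1 : ℕ) : WithTop ℕ∞) := by push_cast; exact le_rfl
    have hsm : ContDiff ℝ n (Function.uncurry f') :=
      (hf.fderiv_right hn).clm_comp contDiff_const
    have hdiff : Differentiable ℝ (Function.uncurry f) :=
      hf.differentiable (by exact_mod_cast Nat.succ_ne_zero n)
    have hd : ∀ x t, HasFDerivAt (fun y => f y t) (f' x t) x := fun x t =>
      HasFDerivAt.comp (g := Function.uncurry f) (f := fun y => (y, t)) x
        (hdiff (x, t)).hasFDerivAt (hasFDerivAt_prodMk_left x t)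
    have key : ∀ x, HasFDerivAt (fun x => ∫ t in (0 : ℝ)..1, f x t)
        (∫ t in (0 : ℝ)..1, f' x t) x := by
      intro x
      obtain ⟨C, hC⟩ := ((isCompact_closedBall x 1).prod
        (isCompact_Icc (a := (0 : ℝ)) (b := 1))).exists_bound_of_continuousOn
          hsm.continuous.continuousOn
      have hcont : ∀ y, Continuous (f y) := fun y =>
        hf.continuous.comp (by fun_prop : Continuous fun t : ℝ => (y, t))
      refine intervalIntegral.hasFDerivAt_integral_of_dominated_of_fderiv_le
        (bound := fun _ => C) (Metric.closedBall_mem_nhds x one_pos)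
        (.of_forall fun y => (hcont y).aestronglyMeasurable)
        ((hcont x).intervalIntegrable 0 1) ?_ ?_ (by simp)
        (.of_forall fun t _ y _ => hd y t)
      · exact (hsm.continuous.comp (by fun_prop : Continuous fun t : ℝ => (x, t)))
          |>.aestronglyMeasurable
      · refine .of_forall fun t ht y hy => hC (y, t) ⟨hy, ?_⟩
        rw [Set.uIoc_of_le zero_le_one] at ht
        exact ⟨ht.1.le, ht.2⟩
    rw [Nat.cast_succ, contDiff_succ_iff_fderiv]
    refine ⟨fun x => (key x).differentiableAt, fun h => absurd h (by simp), ?_⟩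
    rw [funext fun x => (key x).fderiv]
    exact ih hsm

/-- Hadamard's lemma. -/
theorem exists_contDiff_eq_add_sum {N : ℕ} {F : (Fin N → ℝ) → ℝ} (hF : ContDiff ℝ (⊤ : ℕ∞) F)
    (c : Fin N → ℝ) :
    ∃ G : Fin N → (Fin N → ℝ) → ℝ, (∀ i, ContDiff ℝ (⊤ : ℕ∞) (G i)) ∧
      ∀ x, F x = F c + ∑ i, (x i - c i) * G i x := by
  have hdF : ContDiff ℝ (⊤ : ℕ∞) (fderiv ℝ F) := hF.fderiv_right (by simp)
  have hsm : ∀ i, ContDiff ℝ (⊤ : ℕ∞) (Function.uncurry fun (x : Fin N → ℝ) (t : ℝ) =>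
      fderiv ℝ F (c + t • (x - c)) (Pi.single i 1)) := fun i =>
    (hdF.comp (by fun_prop : ContDiff ℝ (⊤ : ℕ∞)
      fun p : (Fin N → ℝ) × ℝ => c + p.2 • (p.1 - c))).clm_apply contDiff_const
  refine ⟨fun i x => ∫ t in (0 : ℝ)..1, fderiv ℝ F (c + t • (x - c)) (Pi.single i 1),
    fun i => contDiff_infty.2 fun n => contDiff_nat_parametric_intervalIntegral n
      (contDiff_infty.1 (hsm i) n), fun x => ?_⟩
  have hd : ∀ t : ℝ, HasDerivAt (fun t : ℝ => F (c + t • (x - c)))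
      (fderiv ℝ F (c + t • (x - c)) (x - c)) t := fun t =>
    ((hF.differentiable (by simp)) _).hasFDerivAt.comp_hasDerivAt t
      (by simpa using ((hasDerivAt_id t).smul_const (x - c)).const_add c)
  have hc : Continuous fun t : ℝ => fderiv ℝ F (c + t • (x - c)) := hdF.continuous.comp (by fun_prop)
  have hint := intervalIntegral.integral_eq_sub_of_hasDerivAt (a := 0) (b := 1)
    (fun t _ => hd t) ((hc.clm_apply continuous_const).intervalIntegrable 0 1)
  have hsum : ∀ t : ℝ, fderiv ℝ F (c + t • (x - c)) (x - c)
      = ∑ i, (x i - c i) * fderiv ℝ F (c + t • (x - c)) (Pi.single i 1) := fun t => by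
    rw [congrArg (fderiv ℝ F (c + t • (x - c))) (pi_eq_sum_univ' (x - c)), map_sum]
    simp [Pi.single]
  simp only [hsum] at hint
  rw [intervalIntegral.integral_finsetSum fun i _ =>
    ((hc.clm_apply continuous_const).const_mul _).intervalIntegrable 0 1] at hint
  simp only [intervalIntegral.integral_const_mul, one_smul, zero_smul, add_zero,
    add_sub_cancel] at hint
  linarith

/-- The domain `(0, 1/2) × ℝ` of the functions `u(ρ, θ)`. -/
def annulus : Set (ℝ × ℝ) := Ioo (0 : ℝ) (1 / 2) ×ˢ univ

theorem isOpen_annulus : IsOpen annulus := isOpen_Ioo.prod isOpen_univ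

/-- Smoothness on the annulus. -/
def SmoothA (u : ℝ → ℝ → ℝ) : Prop := ContDiffOn ℝ (⊤ : ℕ∞) (Function.uncurry u) annulus

/-- Equality on the annulus. -/
def EqA (u v : ℝ → ℝ → ℝ) : Prop := EqOn (Function.uncurry u) (Function.uncurry v) annulus

theorem SmoothA.congr {u v : ℝ → ℝ → ℝ} (hu : SmoothA u) (h : EqA v u) : SmoothA v :=
  ContDiffOn.congr hu h

theorem SmoothA.differentiableAt {u : ℝ → ℝ → ℝ} (hu : SmoothA u) {p : ℝ × ℝ}
    (hp : p ∈ annulus) : DifferentiableAt ℝ (Function.uncurry u) p :=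
  (hu.contDiffAt (isOpen_annulus.mem_nhds hp)).differentiableAt (by simp)

theorem SmoothA.add {u v : ℝ → ℝ → ℝ} (hu : SmoothA u) (hv : SmoothA v) :
    SmoothA (fun ρ θ => u ρ θ + v ρ θ) := ContDiffOn.add hu hv

theorem SmoothA.mul {u v : ℝ → ℝ → ℝ} (hu : SmoothA u) (hv : SmoothA v) :
    SmoothA (fun ρ θ => u ρ θ * v ρ θ) := ContDiffOn.mul hu hv

theorem SmoothA.comp {N : ℕ} {F : (Fin N → ℝ) → ℝ} (hF : ContDiff ℝ (⊤ : ℕ∞) F)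
    {u : Fin N → ℝ → ℝ → ℝ} (hu : ∀ i, SmoothA (u i)) :
    SmoothA (fun ρ θ => F fun i => u i ρ θ) :=
  hF.comp_contDiffOn (f := fun p : ℝ × ℝ => fun i => u i p.1 p.2) (contDiffOn_pi.2 hu)

/-- `D` acts on smooth functions on the annulus as a smooth vector field. -/
def IsVectorField (D : (ℝ → ℝ → ℝ) → ℝ → ℝ → ℝ) : Prop :=
  ∃ V : ℝ × ℝ → ℝ × ℝ, ContDiff ℝ (⊤ : ℕ∞) V ∧
    ∀ u, SmoothA u → ∀ p ∈ annulus, D u p.1 p.2 = fderiv ℝ (Function.uncurry u) p (V p)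

theorem isVectorField_rhoDrho : IsVectorField rhoDrho := by
  refine ⟨fun p => (p.1, 0), by fun_prop, fun u hu p hp => ?_⟩
  have h := HasFDerivAt.comp_hasDerivAt (l := Function.uncurry u) (f := fun r => (r, p.2)) p.1
    (hu.differentiableAt hp).hasFDerivAt ((hasDerivAt_id p.1).prodMk (hasDerivAt_const p.1 p.2))
  have h' : deriv (fun r => u r p.2) p.1 = fderiv ℝ (Function.uncurry u) p (1, 0) := h.deriv
  rw [rhoDrho, h', ← smul_eq_mul, ← map_smul]
  simp

theorem isVectorField_pd_theta : IsVectorField pd_theta := by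
  refine ⟨fun _ => (0, 1), by fun_prop, fun u hu p hp => ?_⟩
  have h := HasFDerivAt.comp_hasDerivAt (l := Function.uncurry u) (f := fun t => (p.1, t)) p.2
    (hu.differentiableAt hp).hasFDerivAt ((hasDerivAt_const p.2 p.1).prodMk (hasDerivAt_id p.2))
  exact h.deriv

namespace IsVectorField

variable {D : (ℝ → ℝ → ℝ) → ℝ → ℝ → ℝ} {u v : ℝ → ℝ → ℝ}

theorem smooth (hD : IsVectorField D) (hu : SmoothA u) : SmoothA (D u) := by
  obtain ⟨V, hV, h⟩ := hD
  exact ((hu.fderiv_of_isOpen isOpen_annulus (by simp)).clm_apply hV.contDiffOn).congr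
    fun p hp => h u hu p hp

theorem congr (hD : IsVectorField D) (hu : SmoothA u) (hv : SmoothA v) (huv : EqA u v) :
    EqA (D u) (D v) := by
  obtain ⟨V, -, h⟩ := hD
  intro p hp
  refine (h u hu p hp).trans (Eq.trans ?_ (h v hv p hp).symm)
  rw [(huv.eventuallyEq_of_mem (isOpen_annulus.mem_nhds hp)).fderiv_eq]

theorem map_add (hD : IsVectorField D) (hu : SmoothA u) (hv : SmoothA v) :
    EqA (D fun ρ θ => u ρ θ + v ρ θ) fun ρ θ => D u ρ θ + D v ρ θ := by
  obtain ⟨V, -, h⟩ := hD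
  intro p hp
  have hfd := ((hu.differentiableAt hp).hasFDerivAt.add (hv.differentiableAt hp).hasFDerivAt).fderiv
  refine (h _ (hu.add hv) p hp).trans ((DFunLike.congr_fun hfd (V p)).trans ?_)
  simp [Function.uncurry, h u hu p hp, h v hv p hp]

theorem map_mul (hD : IsVectorField D) (hu : SmoothA u) (hv : SmoothA v) :
    EqA (D fun ρ θ => u ρ θ * v ρ θ) fun ρ θ => D u ρ θ * v ρ θ + u ρ θ * D v ρ θ := by
  obtain ⟨V, -, h⟩ := hD
  intro p hp
  have hfd := ((hu.differentiableAt hp).hasFDerivAt.mul (hv.differentiableAt hp).hasFDerivAt).fderiv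
  refine (h _ (hu.mul hv) p hp).trans ((DFunLike.congr_fun hfd (V p)).trans ?_)
  simp [Function.uncurry, h u hu p hp, h v hv p hp]
  ring

theorem map_comp (hD : IsVectorField D) {N : ℕ} {F : (Fin N → ℝ) → ℝ}
    (hF : ContDiff ℝ (⊤ : ℕ∞) F) {u : Fin N → ℝ → ℝ → ℝ} (hu : ∀ i, SmoothA (u i)) :
    EqA (D fun ρ θ => F fun i => u i ρ θ)
      fun ρ θ => ∑ i, fderiv ℝ F (fun j => u j ρ θ) (Pi.single i 1) * D (u i) ρ θ := by
  obtain ⟨V, -, h⟩ := hD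
  intro p hp
  have hfd := HasFDerivAt.fderiv <| HasFDerivAt.comp (g := F)
    (f := fun p : ℝ × ℝ => fun i => u i p.1 p.2) p
    ((hF.differentiable (by simp)) _).hasFDerivAt
    (hasFDerivAt_pi.2 fun i => ((hu i).differentiableAt hp).hasFDerivAt)
  refine (h _ (SmoothA.comp hF hu) p hp).trans ((DFunLike.congr_fun hfd (V p)).trans ?_)
  rw [ContinuousLinearMap.comp_apply, pi_eq_sum_univ' (ContinuousLinearMap.pi _ _), map_sum]
  simp [Function.uncurry, h _ (hu _) p hp, Pi.single, mul_comm]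

end IsVectorField

/-- A scale of conditions, indexed by a decay rate, that is stable under addition,
multiplication, and, at rate `0`, smooth composition. -/
structure IsSymbolScale (P : ℝ → (ℝ → ℝ → ℝ) → Prop) : Prop where
  congr {q : ℝ} {u v : ℝ → ℝ → ℝ} : SmoothA u → EqA v u → P q u → P q v
  add {q : ℝ} {u v : ℝ → ℝ → ℝ} : SmoothA u → SmoothA v → P q u → P q v →
    P q (fun ρ θ => u ρ θ + v ρ θ)
  mul {q r : ℝ} {u v : ℝ → ℝ → ℝ} : SmoothA u → SmoothA v → P q u → P r v →
    P (q + r) (fun ρ θ => u ρ θ * v ρ θ)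
  comp {N : ℕ} {F : (Fin N → ℝ) → ℝ} {u : Fin N → ℝ → ℝ → ℝ} : ContDiff ℝ (⊤ : ℕ∞) F →
    (∀ i, SmoothA (u i)) → (∀ i, P 0 (u i)) → P 0 (fun ρ θ => F fun i => u i ρ θ)

/-- The first `n` iterates of `D` on `u` satisfy `P`. -/
def IteratesSat (P : (ℝ → ℝ → ℝ) → Prop) (D : (ℝ → ℝ → ℝ) → ℝ → ℝ → ℝ) :
    ℕ → (ℝ → ℝ → ℝ) → Prop
  | 0, u => P u
  | n + 1, u => P u ∧ IteratesSat P D n (D u)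

section

variable {P : (ℝ → ℝ → ℝ) → Prop} {D : (ℝ → ℝ → ℝ) → ℝ → ℝ → ℝ}

theorem iteratesSat_iff (n : ℕ) : ∀ u, IteratesSat P D n u ↔ ∀ k ≤ n, P (D^[k] u) := by
  induction n with
  | zero => simp [IteratesSat]
  | succ n ih =>
    intro u
    rw [IteratesSat, ih]
    constructor
    · rintro ⟨h0, h⟩ (_ | k) hk
      · exact h0
      · exact h k (by omega)
    · exact fun h => ⟨h 0 (by omega), fun k hk => h (k + 1) (by omega)⟩

theorem IteratesSat.of_succ {n : ℕ} {u : ℝ → ℝ → ℝ} (h : IteratesSat P D (n + 1) u) :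
    IteratesSat P D n u :=
  (iteratesSat_iff n u).2 fun k hk => (iteratesSat_iff (n + 1) u).1 h k (by omega)

end

theorem IsSymbolScale.iteratesSat {P : ℝ → (ℝ → ℝ → ℝ) → Prop}
    {D : (ℝ → ℝ → ℝ) → ℝ → ℝ → ℝ} (hP : IsSymbolScale P) (hD : IsVectorField D) (n : ℕ) :
    IsSymbolScale fun q => IteratesSat (P q) D n := by
  induction n with
  | zero => exact hP
  | succ n ih =>
    refine ⟨fun hu h hPu => ⟨hP.congr hu h hPu.1, ih.congr (hD.smooth hu)
      (hD.congr (hu.congr h) hu h) hPu.2⟩, fun hu hv hPu hPv => ⟨hP.add hu hv hPu.1 hPv.1, ?_⟩,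
      fun hu hv hPu hPv => ⟨hP.mul hu hv hPu.1 hPv.1, ?_⟩,
      fun {N F u} hF hu hPu => ⟨hP.comp hF hu fun i => (hPu i).1, ?_⟩⟩
    · exact ih.congr ((hD.smooth hu).add (hD.smooth hv)) (hD.map_add hu hv)
        (ih.add (hD.smooth hu) (hD.smooth hv) hPu.2 hPv.2)
    · have h1 := (hD.smooth hu).mul hv
      have h2 := hu.mul (hD.smooth hv)
      exact ih.congr (h1.add h2) (hD.map_mul hu hv) (ih.add h1 h2
        (ih.mul (hD.smooth hu) hv hPu.2 hPv.of_succ) (ih.mul hu (hD.smooth hv) hPu.of_succ hPv.2))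
    · have hdF : ∀ i, ContDiff ℝ (⊤ : ℕ∞) fun x => fderiv ℝ F x (Pi.single i 1) := fun i =>
        (hF.fderiv_right (by simp)).clm_apply contDiff_const
      have hS : ContDiff ℝ (⊤ : ℕ∞) fun y : Fin N → ℝ => ∑ i, y i := by fun_prop
      have h1 := fun i => SmoothA.comp (hdF i) hu
      have h2 := fun i => (h1 i).mul (hD.smooth (hu i))
      refine ih.congr (SmoothA.comp hS h2) (hD.map_comp hF hu) (ih.comp hS h2 fun i => ?_)
      simpa using ih.mul (h1 i) (hD.smooth (hu i))
        (ih.comp (hdF i) hu fun i => (hPu i).of_succ) (hPu i).2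

theorem IsSymbolScale.iterate {P : ℝ → (ℝ → ℝ → ℝ) → Prop}
    {D : (ℝ → ℝ → ℝ) → ℝ → ℝ → ℝ} (hP : IsSymbolScale P) (hD : IsVectorField D) :
    IsSymbolScale fun q u => ∀ k, P q (D^[k] u) := by
  have key : ∀ q u, (∀ k, P q (D^[k] u)) ↔ ∀ n, IteratesSat (P q) D n u := fun q u =>
    ⟨fun h n => (iteratesSat_iff n u).2 fun k _ => h k,
      fun h k => (iteratesSat_iff k u).1 (h k) k le_rfl⟩
  simp only [key]
  exact ⟨fun hu h hPu n => (hP.iteratesSat hD n).congr hu h (hPu n),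
    fun hu hv hPu hPv n => (hP.iteratesSat hD n).add hu hv (hPu n) (hPv n),
    fun hu hv hPu hPv n => (hP.iteratesSat hD n).mul hu hv (hPu n) (hPv n),
    fun hF hu hPu n => (hP.iteratesSat hD n).comp hF hu fun i => hPu i n⟩

/-- The pointwise bound `|u| ≤ C ρ^q` on the annulus. -/
def BoundA (q : ℝ) (u : ℝ → ℝ → ℝ) : Prop :=
  ∃ C : ℝ, ∀ ρ θ : ℝ, 0 < ρ → ρ < 1 / 2 → |u ρ θ| ≤ C * ρ ^ q

theorem mk_mem_annulus {ρ : ℝ} (h0 : 0 < ρ) (h1 : ρ < 1 / 2) (θ : ℝ) : (ρ, θ) ∈ annulus :=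
  ⟨⟨h0, h1⟩, mem_univ _⟩

theorem isSymbolScale_boundA : IsSymbolScale BoundA where
  congr := by
    rintro q u v - h ⟨C, hC⟩
    exact ⟨C, fun ρ θ h0 h1 => (congrArg abs (h (mk_mem_annulus h0 h1 θ))).trans_le (hC ρ θ h0 h1)⟩
  add := by
    rintro q u v - - ⟨C, hC⟩ ⟨C', hC'⟩
    refine ⟨C + C', fun ρ θ h0 h1 => (abs_add_le _ _).trans ?_⟩
    rw [add_mul]
    exact add_le_add (hC ρ θ h0 h1) (hC' ρ θ h0 h1)
  mul := by
    rintro q r u v - - ⟨C, hC⟩ ⟨C', hC'⟩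
    refine ⟨C * C', fun ρ θ h0 h1 => ?_⟩
    rw [abs_mul, rpow_add h0, mul_mul_mul_comm]
    exact mul_le_mul (hC ρ θ h0 h1) (hC' ρ θ h0 h1) (abs_nonneg _)
      ((abs_nonneg _).trans (hC ρ θ h0 h1))
  comp := by
    rintro N F u hF - hu
    choose C hC using hu
    obtain ⟨M, hM⟩ := (isCompact_univ_pi fun i => isCompact_Icc (a := -C i) (b := C i))
      |>.exists_bound_of_continuousOn hF.continuous.continuousOn
    refine ⟨M, fun ρ θ h0 h1 => ?_⟩
    simpa using hM (fun i => u i ρ θ) fun i _ => abs_le.1 (by simpa using hC i ρ θ h0 h1)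

/-- Membership in `Õ(q)` without the periodicity condition. -/
def IsSymbol (q : ℝ) (u : ℝ → ℝ → ℝ) : Prop :=
  SmoothA u ∧ ∀ k2 k1 : ℕ, BoundA q (rhoDrho^[k1] (pd_theta^[k2] u))

theorem isSymbolScale_bounds :
    IsSymbolScale fun q u => ∀ k2 k1 : ℕ, BoundA q (rhoDrho^[k1] (pd_theta^[k2] u)) :=
  (isSymbolScale_boundA.iterate isVectorField_rhoDrho).iterate isVectorField_pd_theta

namespace IsSymbol

variable {q r : ℝ} {u v : ℝ → ℝ → ℝ}

theorem congr (hu : IsSymbol q u) (h : EqA v u) : IsSymbol q v :=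
  ⟨hu.1.congr h, isSymbolScale_bounds.congr hu.1 h hu.2⟩

theorem add (hu : IsSymbol q u) (hv : IsSymbol q v) : IsSymbol q fun ρ θ => u ρ θ + v ρ θ :=
  ⟨hu.1.add hv.1, isSymbolScale_bounds.add hu.1 hv.1 hu.2 hv.2⟩

theorem mul (hu : IsSymbol q u) (hv : IsSymbol r v) :
    IsSymbol (q + r) fun ρ θ => u ρ θ * v ρ θ :=
  ⟨hu.1.mul hv.1, isSymbolScale_bounds.mul hu.1 hv.1 hu.2 hv.2⟩

theorem comp {N : ℕ} {F : (Fin N → ℝ) → ℝ} {u : Fin N → ℝ → ℝ → ℝ}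
    (hF : ContDiff ℝ (⊤ : ℕ∞) F) (hu : ∀ i, IsSymbol 0 (u i)) :
    IsSymbol 0 fun ρ θ => F fun i => u i ρ θ :=
  ⟨SmoothA.comp hF fun i => (hu i).1,
    isSymbolScale_bounds.comp hF (fun i => (hu i).1) fun i => (hu i).2⟩

theorem mono (hu : IsSymbol q u) (hrq : r ≤ q) : IsSymbol r u := by
  refine ⟨hu.1, fun k2 k1 => ?_⟩
  obtain ⟨C, hC⟩ := hu.2 k2 k1
  refine ⟨|C|, fun ρ θ h0 h1 => (hC ρ θ h0 h1).trans ?_⟩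
  exact mul_le_mul (le_abs_self C) (rpow_le_rpow_of_exponent_ge h0 (by linarith) hrq)
    (by positivity) (abs_nonneg C)

theorem const (c : ℝ) : IsSymbol 0 fun _ _ => c :=
  comp (F := fun _ : Fin 0 → ℝ => c) (u := fun _ _ _ => 0) contDiff_const fun i => i.elim0

theorem const_mul (hu : IsSymbol q u) (c : ℝ) : IsSymbol q fun ρ θ => c * u ρ θ := by
  simpa using (const c).mul hu

theorem zero : IsSymbol q fun _ _ => 0 := by
  refine ⟨contDiffOn_const, fun k2 k1 => ⟨0, fun ρ θ _ _ => ?_⟩⟩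
  have h1 : rhoDrho (fun _ _ => 0) = fun _ _ => 0 := by ext; simp [rhoDrho]
  have h2 : pd_theta (fun _ _ => 0) = fun _ _ => 0 := by ext; simp [pd_theta]
  simp [Function.iterate_fixed h1, Function.iterate_fixed h2]

theorem sum {ι : Type*} (s : Finset ι) {u : ι → ℝ → ℝ → ℝ} (hu : ∀ i ∈ s, IsSymbol q (u i)) :
    IsSymbol q fun ρ θ => ∑ i ∈ s, u i ρ θ := by
  classical
  induction s using Finset.induction_on with
  | empty => simpa using zero
  | insert i s hi ih =>
    simp only [Finset.sum_insert hi]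
    exact (hu i (by simp)).add (ih fun j hj => hu j (by simp [hj]))

end IsSymbol

theorem exists_eqA_iterate {D : (ℝ → ℝ → ℝ) → ℝ → ℝ → ℝ} (hD : IsVectorField D)
    {R : (ℝ → ℝ → ℝ) → Prop} (hR : ∀ u, R u → SmoothA u)
    (hDR : ∀ u, R u → ∃ v, R v ∧ EqA (D u) v) (k : ℕ) :
    ∀ u w, R u → EqA w u → ∃ v, R v ∧ EqA (D^[k] w) v := by
  induction k with
  | zero => exact fun u w hu h => ⟨u, hu, h⟩
  | succ k ih =>
    intro u w hu h
    obtain ⟨v, hv, hDv⟩ := hDR u hu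
    exact ih v (D w) hv ((hD.congr ((hR u hu).congr h) (hR u hu) h).trans hDv)

/-- The function `ρ^a p(log ρ) (A cos (lθ) + B sin (lθ))`. -/
noncomputable def polyLogTrig (a l : ℝ) (p : Polynomial ℝ) (A B : ℝ) : ℝ → ℝ → ℝ :=
  fun ρ θ => ρ ^ a * p.eval (log ρ) * (A * cos (l * θ) + B * sin (l * θ))

theorem smoothA_polyLogTrig (a l : ℝ) (p : Polynomial ℝ) (A B : ℝ) :
    SmoothA (polyLogTrig a l p A B) := by
  have h0 : ∀ x ∈ annulus, x.1 ≠ 0 := fun x hx => hx.1.1.ne'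
  have hr : ContDiffOn ℝ (⊤ : ℕ∞) (fun x : ℝ × ℝ => x.1 ^ a) annulus :=
    contDiffOn_fst.rpow_const_of_ne h0
  have hl : ContDiffOn ℝ (⊤ : ℕ∞) (fun x : ℝ × ℝ => p.eval (log x.1)) annulus :=
    (by simpa using p.contDiff_aeval (𝕜 := ℝ) _ :
      ContDiff ℝ (⊤ : ℕ∞) fun x => p.eval x).comp_contDiffOn (contDiffOn_fst.log h0)
  have ht : ContDiff ℝ (⊤ : ℕ∞) (fun x : ℝ × ℝ => A * cos (l * x.2) + B * sin (l * x.2)) := by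
    fun_prop
  exact (hr.mul hl).mul ht.contDiffOn

theorem rhoDrho_polyLogTrig (a l : ℝ) (p : Polynomial ℝ) (A B : ℝ) :
    EqA (rhoDrho (polyLogTrig a l p A B))
      (polyLogTrig a l (Polynomial.C a * p + Polynomial.derivative p) A B) := by
  rintro ⟨ρ, θ⟩ ⟨⟨h0, -⟩, -⟩
  have h0 : 0 < ρ := h0
  have h := ((hasDerivAt_rpow_const (p := a) (Or.inl h0.ne')).mul
    ((p.hasDerivAt (log ρ)).comp ρ (hasDerivAt_log h0.ne'))).mul_const
      (A * cos (l * θ) + B * sin (l * θ))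
  have h' : deriv (fun r => polyLogTrig a l p A B r θ) ρ = _ := h.deriv
  simp only [Function.uncurry, rhoDrho]
  rw [h']
  simp only [polyLogTrig, rpow_sub_one h0.ne', Function.comp_apply,
    Polynomial.eval_add, Polynomial.eval_mul, Polynomial.eval_C]
  field_simp

theorem pd_theta_polyLogTrig (a l : ℝ) (p : Polynomial ℝ) (A B : ℝ) :
    EqA (pd_theta (polyLogTrig a l p A B)) (polyLogTrig a l p (l * B) (-(l * A))) := by
  rintro ⟨ρ, θ⟩ -
  have hl : HasDerivAt (fun t : ℝ => l * t) l θ := by simpa using (hasDerivAt_id θ).const_mul l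
  have h := ((hl.cos.const_mul A).add (hl.sin.const_mul B)).const_mul (ρ ^ a * p.eval (log ρ))
  have h' : deriv (fun t => polyLogTrig a l p A B ρ t) θ = _ := h.deriv
  simp only [Function.uncurry, pd_theta]
  rw [h', polyLogTrig]
  ring

theorem exists_abs_eval_log_mul_rpow_le (p : Polynomial ℝ) {s : ℝ} (hs : 0 < s) :
    ∃ C, ∀ ρ : ℝ, 0 < ρ → ρ ≤ 1 → |p.eval (log ρ) * ρ ^ s| ≤ C := by
  induction p using Polynomial.induction_on' with
  | add p p' hp hp' =>
    obtain ⟨C, hC⟩ := hp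
    obtain ⟨C', hC'⟩ := hp'
    refine ⟨C + C', fun ρ h0 h1 => ?_⟩
    rw [Polynomial.eval_add, add_mul]
    exact (abs_add_le _ _).trans (add_le_add (hC ρ h0 h1) (hC' ρ h0 h1))
  | monomial m c =>
    set t : ℝ := s / (m + 1) with ht
    have htpos : 0 < t := by positivity
    refine ⟨|c| * (1 / t) ^ m, fun ρ h0 h1 => ?_⟩
    have hst : ρ ^ s = (ρ ^ t) ^ m * ρ ^ t := by
      rw [← pow_succ, ← rpow_natCast, ← rpow_mul h0.le, ht]
      congr 1
      push_cast
      field_simp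
    rw [Polynomial.eval_monomial, hst]
    calc |c * log ρ ^ m * ((ρ ^ t) ^ m * ρ ^ t)| = |c| * |log ρ * ρ ^ t| ^ m * ρ ^ t := by
          rw [← abs_pow, ← abs_of_pos (rpow_pos_of_pos h0 t), ← abs_mul, ← abs_mul,
            abs_of_pos (rpow_pos_of_pos h0 t)]
          ring_nf
      _ ≤ |c| * (1 / t) ^ m * 1 := by
          gcongr
          · exact (abs_log_mul_self_rpow_lt ρ t h0 h1 htpos).le
          · exact rpow_le_one h0.le h1 htpos.le
      _ = _ := mul_one _

theorem boundA_polyLogTrig {a q : ℝ} (hqa : q < a) (l : ℝ) (p : Polynomial ℝ) (A B : ℝ) :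
    BoundA q (polyLogTrig a l p A B) := by
  obtain ⟨C, hC⟩ := exists_abs_eval_log_mul_rpow_le p (sub_pos.2 hqa)
  refine ⟨C * (|A| + |B|), fun ρ θ h0 h1 => ?_⟩
  have htrig : |A * cos (l * θ) + B * sin (l * θ)| ≤ |A| + |B| := by
    refine (abs_add_le _ _).trans (add_le_add ?_ ?_) <;> rw [abs_mul]
    · exact mul_le_of_le_one_right (abs_nonneg A) (abs_cos_le_one _)
    · exact mul_le_of_le_one_right (abs_nonneg B) (abs_sin_le_one _)
  have hC' := hC ρ h0 (by linarith)
  have heq : ρ ^ a = ρ ^ (a - q) * ρ ^ q := by rw [← rpow_add h0, sub_add_cancel]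
  calc |polyLogTrig a l p A B ρ θ|
      = |p.eval (log ρ) * ρ ^ (a - q)| * |A * cos (l * θ) + B * sin (l * θ)| * ρ ^ q := by
        rw [polyLogTrig, heq, ← abs_of_pos (rpow_pos_of_pos h0 q), ← abs_mul, ← abs_mul,
          abs_of_pos (rpow_pos_of_pos h0 q)]
        ring_nf
    _ ≤ C * (|A| + |B|) * ρ ^ q := by
        gcongr
        exact (abs_nonneg _).trans hC'

theorem isSymbol_polyLogTrig {a q : ℝ} (hqa : q < a) (l : ℝ) (p : Polynomial ℝ) (A B : ℝ) :
    IsSymbol q (polyLogTrig a l p A B) := by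
  set R : (ℝ → ℝ → ℝ) → Prop := fun u => ∃ p A B, u = polyLogTrig a l p A B
  have hR : ∀ u, R u → SmoothA u := by
    rintro _ ⟨p, A, B, rfl⟩
    exact smoothA_polyLogTrig a l p A B
  refine ⟨hR _ ⟨p, A, B, rfl⟩, fun k2 k1 => ?_⟩
  obtain ⟨v, hv, hev⟩ := exists_eqA_iterate isVectorField_pd_theta hR
    (by rintro _ ⟨p, A, B, rfl⟩; exact ⟨_, ⟨_, _, _, rfl⟩, pd_theta_polyLogTrig a l p A B⟩)
    k2 _ _ ⟨p, A, B, rfl⟩ (fun _ _ => rfl)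
  obtain ⟨w, hw, hew⟩ := exists_eqA_iterate isVectorField_rhoDrho hR
    (by rintro _ ⟨p, A, B, rfl⟩; exact ⟨_, ⟨_, _, _, rfl⟩, rhoDrho_polyLogTrig a l p A B⟩)
    k1 _ _ hv hev
  obtain ⟨p', A', B', rfl⟩ := hw
  exact isSymbolScale_boundA.congr (smoothA_polyLogTrig a l p' A' B') hew
    (boundA_polyLogTrig hqa l p' A' B')

/-- The function `ρ^{2j+k/β} (log ρ)^m cos (l θ + φ)`. -/
noncomputable def tlogPhase (β : ℝ) (j k m l : ℕ) (φ : ℝ) : ℝ → ℝ → ℝ :=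
  fun ρ θ => ρ ^ (2 * (j : ℝ) + (k : ℝ) / β) * (log ρ) ^ m * cos (l * θ + φ)

theorem exists_eq_tlogPhase {β : ℝ} {f : ℝ → ℝ → ℝ} (hf : f ∈ Tlog β) :
    ∃ j k m l φ, TlogIdx j k m l ∧ f = tlogPhase β j k m l φ := by
  obtain ⟨j, k, m, l, h, rfl | rfl⟩ := hf
  · exact ⟨j, k, m, l, 0, h, by ext; simp [tlogPhase, tlogCos]⟩
  · exact ⟨j, k, m, l, -(π / 2), h, by
      ext; simp [tlogPhase, tlogSin, ← sub_eq_add_neg, cos_sub_pi_div_two]⟩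

theorem tlogPhase_mem_span {β : ℝ} {j k m l : ℕ} (h : TlogIdx j k m l) (φ : ℝ) :
    tlogPhase β j k m l φ ∈ Submodule.span ℝ (Tlog β) := by
  have heq : tlogPhase β j k m l φ
      = cos φ • tlogCos β j k m l - sin φ • tlogSin β j k m l := by
    ext ρ θ
    simp only [tlogPhase, tlogCos, tlogSin, cos_add, Pi.sub_apply, Pi.smul_apply, smul_eq_mul]
    ring
  rw [heq]
  exact Submodule.sub_mem _
    (Submodule.smul_mem _ _ (Submodule.subset_span ⟨j, k, m, l, h, Or.inl rfl⟩))
    (Submodule.smul_mem _ _ (Submodule.subset_span ⟨j, k, m, l, h, Or.inr rfl⟩))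

theorem tlogPhase_mul {β : ℝ} {j k m l j' k' m' l' : ℕ} (φ φ' : ℝ) (hl : l' ≤ l) :
    EqA (tlogPhase β j k m l φ * tlogPhase β j' k' m' l' φ')
      ((1 / 2 : ℝ) • (tlogPhase β (j + j') (k + k') (m + m') (l + l') (φ + φ')
        + tlogPhase β (j + j') (k + k') (m + m') (l - l') (φ - φ'))) := by
  rintro ⟨ρ, θ⟩ ⟨⟨h0, -⟩, -⟩
  have h0 : 0 < ρ := h0
  have hexp : 2 * ((j + j' : ℕ) : ℝ) + ((k + k' : ℕ) : ℝ) / β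
      = (2 * (j : ℝ) + k / β) + (2 * (j' : ℝ) + k' / β) := by push_cast; ring
  have ha : ((l + l' : ℕ) : ℝ) * θ + (φ + φ') = (l * θ + φ) + (l' * θ + φ') := by
    push_cast; ring
  have hs : ((l - l' : ℕ) : ℝ) * θ + (φ - φ') = (l * θ + φ) - (l' * θ + φ') := by
    push_cast [hl]; ring
  simp only [Function.uncurry, tlogPhase, Pi.mul_apply, Pi.smul_apply, Pi.add_apply, smul_eq_mul]
  rw [hexp, ha, hs, rpow_add h0 (2 * (j : ℝ) + k / β), cos_add (_ * _ + _), cos_sub (_ * _ + _), pow_add]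
  ring

theorem exists_mem_span_eqA_tlogPhase_mul {β : ℝ} {j k m l j' k' m' l' : ℕ} (φ φ' : ℝ)
    (h : TlogIdx j k m l) (h' : TlogIdx j' k' m' l') (hl : l' ≤ l) :
    ∃ g ∈ Submodule.span ℝ (Tlog β),
      EqA (tlogPhase β j k m l φ * tlogPhase β j' k' m' l' φ') g := by
  refine ⟨_, Submodule.smul_mem _ _ (Submodule.add_mem _ (tlogPhase_mem_span ?_ _)
    (tlogPhase_mem_span ?_ _)), tlogPhase_mul φ φ' hl⟩
  all_goals
    obtain ⟨⟨i, hi⟩, hm⟩ := h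
    obtain ⟨⟨i', hi'⟩, hm'⟩ := h'
  · exact ⟨⟨i + i', by omega⟩, by omega⟩
  · exact ⟨⟨i + i' + l', by omega⟩, by omega⟩

theorem exists_mem_span_eqA_mul {β : ℝ} {f g : ℝ → ℝ → ℝ}
    (hf : f ∈ Submodule.span ℝ (Tlog β)) (hg : g ∈ Submodule.span ℝ (Tlog β)) :
    ∃ h ∈ Submodule.span ℝ (Tlog β), EqA (f * g) h := by
  induction hf, hg using Submodule.span_induction₂ with
  | mem_mem f g hf hg =>
    obtain ⟨j, k, m, l, φ, h, rfl⟩ := exists_eq_tlogPhase hf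
    obtain ⟨j', k', m', l', φ', h', rfl⟩ := exists_eq_tlogPhase hg
    rcases le_total l' l with hl | hl
    · exact exists_mem_span_eqA_tlogPhase_mul φ φ' h h' hl
    · rw [mul_comm]
      exact exists_mem_span_eqA_tlogPhase_mul φ' φ h' h hl
  | zero_left g _ => exact ⟨0, zero_mem _, by rw [zero_mul]; exact fun _ _ => rfl⟩
  | zero_right f _ => exact ⟨0, zero_mem _, by rw [mul_zero]; exact fun _ _ => rfl⟩
  | add_left f f' g _ _ _ h h' =>
    obtain ⟨r, hr, her⟩ := h
    obtain ⟨r', hr', her'⟩ := h'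
    refine ⟨r + r', add_mem hr hr', fun p hp => ?_⟩
    rw [add_mul]
    exact congrArg₂ (· + ·) (her hp) (her' hp)
  | add_right f g g' _ _ _ h h' =>
    obtain ⟨r, hr, her⟩ := h
    obtain ⟨r', hr', her'⟩ := h'
    refine ⟨r + r', add_mem hr hr', fun p hp => ?_⟩
    rw [mul_add]
    exact congrArg₂ (· + ·) (her hp) (her' hp)
  | smul_left c f g _ _ h =>
    obtain ⟨r, hr, her⟩ := h
    refine ⟨c • r, Submodule.smul_mem _ c hr, fun p hp => ?_⟩
    rw [smul_mul_assoc]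
    exact congrArg (c * ·) (her hp)
  | smul_right c f g _ _ h =>
    obtain ⟨r, hr, her⟩ := h
    refine ⟨c • r, Submodule.smul_mem _ c hr, fun p hp => ?_⟩
    rw [mul_smul_comm]
    exact congrArg (c * ·) (her hp)

theorem const_mem_span_Tlog (β c : ℝ) :
    (fun _ _ => c : ℝ → ℝ → ℝ) ∈ Submodule.span ℝ (Tlog β) := by
  have h := Submodule.smul_mem _ c (tlogPhase_mem_span (β := β)
    (j := 0) (k := 0) (m := 0) (l := 0) ⟨⟨0, rfl⟩, by simp⟩ 0)
  convert h using 1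
  ext ρ θ
  simp [tlogPhase]

theorem periodic_of_mem_span_Tlog {β : ℝ} {η : ℝ → ℝ → ℝ}
    (hη : η ∈ Submodule.span ℝ (Tlog β)) (ρ θ : ℝ) : η ρ (θ + 2 * π) = η ρ θ := by
  induction hη using Submodule.span_induction with
  | mem f hf =>
    obtain ⟨j, k, m, l, φ, -, rfl⟩ := exists_eq_tlogPhase hf
    have : (l : ℝ) * (θ + 2 * π) + φ = (l * θ + φ) + l * (2 * π) := by ring
    rw [tlogPhase, this, cos_add_nat_mul_two_pi]
    rfl
  | zero => rfl
  | add f g _ _ hf hg => exact congrArg₂ (· + ·) hf hg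
  | smul c f _ hf => exact congrArg (c * ·) hf

/-- An element of the span of `Tlog β` is a constant up to a decaying symbol. -/
theorem exists_const_isSymbol_sub {β : ℝ} (hβ0 : 0 < β) (hβ1 : β < 1) {η : ℝ → ℝ → ℝ}
    (hη : η ∈ Submodule.span ℝ (Tlog β)) :
    ∃ c : ℝ, IsSymbol (1 / 2) fun ρ θ => η ρ θ - c := by
  induction hη using Submodule.span_induction with
  | mem f hf =>
    obtain ⟨j, k, m, l, φ, ⟨⟨i, hi⟩, hm⟩, rfl⟩ := exists_eq_tlogPhase hf
    by_cases hjk : j = 0 ∧ k = 0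
    · obtain ⟨rfl, rfl⟩ := hjk
      obtain rfl : l = 0 := by omega
      obtain rfl : m = 0 := by omega
      exact ⟨cos φ, by simpa [tlogPhase] using IsSymbol.zero⟩
    · have hk : (k : ℝ) ≤ k / β := le_div_self k.cast_nonneg hβ0 hβ1.le
      have hjk' : (1 : ℝ) ≤ j + k := by exact_mod_cast (by omega : 1 ≤ j + k)
      have hj : (0 : ℝ) ≤ j := j.cast_nonneg
      refine ⟨0, (isSymbol_polyLogTrig (a := 2 * (j : ℝ) + k / β) (by linarith) l
        (Polynomial.X ^ m) (cos φ) (-sin φ)).congr fun p _ => ?_⟩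
      simp only [Function.uncurry, tlogPhase, polyLogTrig, cos_add, Polynomial.eval_pow,
        Polynomial.eval_X]
      ring
  | zero => exact ⟨0, by simpa using IsSymbol.zero⟩
  | add f g _ _ hf hg =>
    obtain ⟨c, hc⟩ := hf
    obtain ⟨d, hd⟩ := hg
    refine ⟨c + d, (hc.add hd).congr fun p _ => ?_⟩
    simp only [Function.uncurry, Pi.add_apply]
    ring
  | smul r f _ hf =>
    obtain ⟨c, hc⟩ := hf
    refine ⟨r * c, (hc.const_mul r).congr fun p _ => ?_⟩
    simp only [Function.uncurry, Pi.smul_apply, smul_eq_mul]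
    ring

theorem isSymbol_of_mem_span_Tlog {β : ℝ} (hβ0 : 0 < β) (hβ1 : β < 1) {η : ℝ → ℝ → ℝ}
    (hη : η ∈ Submodule.span ℝ (Tlog β)) : IsSymbol 0 η := by
  obtain ⟨c, hc⟩ := exists_const_isSymbol_sub hβ0 hβ1 hη
  simpa using (hc.mono (by norm_num)).add (IsSymbol.const c)

/-- Each application of Hadamard's lemma improves the order of the expansion by `δ`. -/
theorem exists_mem_span_isSymbol_comp_sub {β : ℝ} (hβ0 : 0 < β) (hβ1 : β < 1) {q δ : ℝ}
    (hq : 0 ≤ q) (hδq : δ ≤ q) (hδ0 : 0 ≤ δ) (hδ : δ ≤ 1 / 2) {N : ℕ} {u η : Fin N → ℝ → ℝ → ℝ}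
    (hη : ∀ i, η i ∈ Submodule.span ℝ (Tlog β))
    (hw : ∀ i, IsSymbol q fun ρ θ => u i ρ θ - η i ρ θ) (n : ℕ) :
    ∀ F : (Fin N → ℝ) → ℝ, ContDiff ℝ (⊤ : ℕ∞) F →
      ∃ ζ ∈ Submodule.span ℝ (Tlog β),
        IsSymbol (min q (n * δ)) fun ρ θ => F (fun i => u i ρ θ) - ζ ρ θ := by
  choose c hc using fun i => exists_const_isSymbol_sub hβ0 hβ1 (hη i)
  have huc : ∀ i, IsSymbol δ fun ρ θ => u i ρ θ - c i := fun i => by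
    simpa using ((hw i).mono hδq).add ((hc i).mono hδ)
  have hu : ∀ i, IsSymbol 0 (u i) := fun i => by
    simpa using ((huc i).mono hδ0).add (IsSymbol.const (c i))
  induction n with
  | zero =>
    intro F hF
    refine ⟨0, zero_mem _, ?_⟩
    simpa [hq] using IsSymbol.comp hF hu
  | succ n ih =>
    intro F hF
    obtain ⟨G, hG, hFG⟩ := exists_contDiff_eq_add_sum hF c
    choose a ha hGa using fun i => ih (G i) (hG i)
    choose b hb hab using fun i => exists_mem_span_eqA_mul
      (sub_mem (hη i) (const_mem_span_Tlog β (c i))) (ha i)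
    refine ⟨(fun _ _ => F c) + ∑ i, b i,
      add_mem (const_mem_span_Tlog β _) (sum_mem fun i _ => hb i), ?_⟩
    have h1 : ∀ i, IsSymbol (min q ((n + 1 : ℕ) * δ))
        fun ρ θ => (u i ρ θ - c i) * (G i (fun i => u i ρ θ) - a i ρ θ) := fun i => by
      refine ((huc i).mul (hGa i)).mono ?_
      rcases le_total q (n * δ) with h | h
      · rw [min_eq_left h]
        exact (min_le_left _ _).trans (by linarith)
      · rw [min_eq_right h]
        exact (min_le_right _ _).trans (by push_cast; linarith)
    have h2 : ∀ i, IsSymbol (min q ((n + 1 : ℕ) * δ))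
        fun ρ θ => (u i ρ θ - η i ρ θ) * a i ρ θ := fun i => by
      refine ((hw i).mul (isSymbol_of_mem_span_Tlog hβ0 hβ1 (ha i))).mono ?_
      rw [add_zero]
      exact min_le_left _ _
    refine (IsSymbol.sum Finset.univ fun i _ => (h1 i).add (h2 i)).congr fun p hp => ?_
    have hab' : ∀ i, (η i p.1 p.2 - c i) * a i p.1 p.2 = b i p.1 p.2 := fun i => hab i hp
    simp only [Function.uncurry, Pi.add_apply, Finset.sum_apply, ← hab']
    rw [hFG fun i => u i p.1 p.2, add_sub_add_left_eq_sub, ← Finset.sum_sub_distrib]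
    exact Finset.sum_congr rfl fun i _ => by ring

/-- a smooth function of functions having expansions up to order `q ≥ 0`
again has an expansion up to order `q`. -/
theorem stmt13 (β : ℝ) (hβ0 : 0 < β) (hβ1 : β < 1) (N : ℕ) (hN : 1 ≤ N)
    (F : (Fin N → ℝ) → ℝ) (hF : ContDiff ℝ (⊤ : ℕ∞) F)
    (q : ℝ) (hq : 0 ≤ q) (u : Fin N → ℝ → ℝ → ℝ)
    (hu : ∀ i : Fin N, HasExpansion β q (u i)) :
    HasExpansion β q (fun ρ θ => F (fun i => u i ρ θ)) := by
  choose η hη hw using hu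
  have hδ0 : 0 ≤ min q (1 / 2) := le_min hq (by norm_num)
  obtain ⟨n, hn⟩ : ∃ n : ℕ, q ≤ n * min q (1 / 2) := by
    rcases hq.eq_or_lt with rfl | hq
    · exact ⟨0, by simp⟩
    · obtain ⟨n, hn⟩ := exists_nat_ge (q / min q (1 / 2))
      exact ⟨n, (div_le_iff₀ (lt_min hq (by norm_num))).1 hn⟩
  obtain ⟨ζ, hζ, hζs⟩ := exists_mem_span_isSymbol_comp_sub hβ0 hβ1 hq (min_le_left _ _) hδ0
    (min_le_right _ _) hη (fun i => ⟨(hw i).1, fun k2 k1 => (hw i).2.2 k1 k2⟩) n F hF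
  rw [min_eq_left hn] at hζs
  have hper : ∀ i ρ θ, u i ρ (θ + 2 * π) = u i ρ θ := fun i ρ θ => by
    have h := (hw i).2.1 ρ θ
    simp only [periodic_of_mem_span_Tlog (hη i)] at h
    linarith
  refine ⟨ζ, hζ, hζs.1, fun ρ θ => ?_, fun k1 k2 => hζs.2 k2 k1⟩
  simp only [hper, periodic_of_mem_span_Tlog hζ]
end
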